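/- Modulation estimates at threshold energy: there exist δ₀ > 0 and C > 0 such that the following holds. Let f : ℝ³ → ℂ be radial, continuously differentiable, with f ∈ L²(ℝ³) ∩ L⁴(ℝ³) ∩ L⁶(ℝ³) and ∇f ∈ L²(ℝ³), let θ ∈ ℝ and μ > 0, and set g := e^{−iθ} f − μ^{1/2} W(μ·). Assume E(f) = E^c(W), ‖∇g‖_{L²} ≤ δ₀, and the orthogonality conditions ∫_{ℝ³} ∇(Im g)·∇( μ^{1/2} W(μ·) ) dx = 0 and ∫_{ℝ³} ∇(Re g)·∇( μ^{1/2} W₁(μ·) ) dx = 0. Then, with δ(f) := |‖∇W‖_{L²}² − ‖∇f‖_{L²}²|, one has ∫_{ℝ³} |f|⁴ dx ≤ C δ(f)² and C⁻¹ δ(f) ≤ ‖∇g‖_{L²} ≤ C δ(f). -/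

import Mathlib

open MeasureTheory Complex
open scoped BigOperators ENNReal

noncomputable section

abbrev E3 := EuclideanSpace ℝ (Fin 3)

/-- The Aubin–Talenti ground state `W(x) = (1 + |x|²/3)^(-1/2)`. -/
def W (x : E3) : ℝ := (1 + ‖x‖ ^ 2 / 3) ^ (-(1 : ℝ) / 2)

/-- `W` viewed as a complex-valued function. -/
def Wc (x : E3) : ℂ := (W x : ℂ)

/-- Standard basis vectors of ℝ³. -/
def e3 (i : Fin 3) : E3 := EuclideanSpace.single i 1

/-- Partial derivative of a real-valued function. -/
def pdR (i : Fin 3) (f : E3 → ℝ) (x : E3) : ℝ := fderiv ℝ f x (e3 i)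

/-- Partial derivative of a complex-valued function. -/
def pdC (i : Fin 3) (f : E3 → ℂ) (x : E3) : ℂ := fderiv ℝ f x (e3 i)

/-- Squared gradient `|∇f|²` of a real-valued function. -/
def gradSqR (f : E3 → ℝ) (x : E3) : ℝ := ∑ i, (pdR i f x) ^ 2

/-- Squared gradient `|∇f|²` of a complex-valued function. -/
def gradSqC (f : E3 → ℂ) (x : E3) : ℝ := ∑ i, ‖pdC i f x‖ ^ 2

/-- Laplacian of a real-valued function. -/
def lapR (f : E3 → ℝ) (x : E3) : ℝ := ∑ i, pdR i (pdR i f) x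

/-- Laplacian of a complex-valued function. -/
def lapC (f : E3 → ℂ) (x : E3) : ℂ := ∑ i, pdC i (pdC i f) x

/-- Quintic (energy-critical) energy `E^c`. -/
def Ecrit (f : E3 → ℂ) : ℝ := ∫ x : E3, ((1:ℝ)/2 * gradSqC f x - 1/6 * ‖f x‖ ^ 6)

/-- Cubic–quintic energy `E`. -/
def Ecq (f : E3 → ℂ) : ℝ :=
  ∫ x : E3, ((1:ℝ)/2 * gradSqC f x - 1/6 * ‖f x‖ ^ 6 + 1/4 * ‖f x‖ ^ 4)

/-- Regular solutions of the cubic–quintic NLS on an interval `I ⊆ ℝ`. -/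
def IsRegularSolution (I : Set ℝ) (u : ℝ → E3 → ℂ) : Prop :=
  ContDiffOn ℝ (⊤ : ℕ∞) (fun p : ℝ × E3 => u p.1 p.2) (I ×ˢ Set.univ) ∧
  (∀ t ∈ I, ∀ x : E3, Complex.I * deriv (fun s => u s x) t + lapC (u t) x =
      (‖u t x‖ : ℂ) ^ 2 * u t x - (‖u t x‖ : ℂ) ^ 4 * u t x) ∧
  (∀ J : Set ℝ, IsCompact J → J ⊆ I → ∀ n k : ℕ, ∃ C : ℝ, ∀ t ∈ J, ∀ x : E3,
      (1 + ‖x‖) ^ n * ‖iteratedFDeriv ℝ k (u t) x‖ ≤ C)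


/-- A function on ℝ³ is radial if it depends only on the norm. -/
def IsRadial {α : Type*} (f : E3 → α) : Prop := ∀ x y : E3, ‖x‖ = ‖y‖ → f x = f y

/-- `W₁ = ½W + x·∇W`. -/
def W1 (x : E3) : ℝ := (1:ℝ)/2 * W x + fderiv ℝ W x x

/-- The modulation remainder `g = e^{-iθ} f - μ^{1/2} W(μ·)`. -/
def modG (f : E3 → ℂ) (θ μ : ℝ) (x : E3) : ℂ :=
  Complex.exp (-θ * Complex.I) * f x - ((Real.sqrt μ * W (μ • x) : ℝ) : ℂ)

/-- `δ(f) = |‖∇W‖_{L²}² − ‖∇f‖_{L²}²|`. -/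
def deltaF (f : E3 → ℂ) : ℝ := |(∫ x : E3, gradSqR W x) - ∫ x : E3, gradSqC f x|


/-! ### The radial profile of the ground state -/

/-- The radial profile of `W`. -/
def radialW (r : ℝ) : ℝ := (1 + r ^ 2 / 3) ^ (-(1 : ℝ) / 2)

/-- The radial profile of `W1`. -/
def radialW1 (r : ℝ) : ℝ := (3 - r ^ 2) / 6 * radialW r ^ 3

lemma radialW_pos (r : ℝ) : 0 < radialW r := Real.rpow_pos_of_pos (by positivity) _

lemma radialW_sq (r : ℝ) : radialW r ^ 2 * (3 + r ^ 2) = 3 := by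
  have h : (0 : ℝ) < 1 + r ^ 2 / 3 := by positivity
  have h2 : radialW r ^ 2 = (1 + r ^ 2 / 3)⁻¹ := by
    rw [radialW, ← Real.rpow_natCast, ← Real.rpow_mul h.le, ← Real.rpow_neg_one]
    norm_num
  rw [h2]
  field_simp

lemma hasDerivAt_radialW (r : ℝ) : HasDerivAt radialW (-(r / 3) * radialW r ^ 3) r := by
  have h : (0 : ℝ) < 1 + r ^ 2 / 3 := by positivity
  have h3 : radialW r ^ 3 = (1 + r ^ 2 / 3) ^ (-(1 : ℝ) / 2 - 1) := by
    rw [radialW, ← Real.rpow_natCast, ← Real.rpow_mul h.le]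
    norm_num
  have hd : HasDerivAt (fun r : ℝ => 1 + r ^ 2 / 3) (2 * r / 3) r := by
    have := ((hasDerivAt_pow 2 r).div_const 3).const_add 1
    simpa using this
  have := hd.rpow_const (p := -(1 : ℝ) / 2) (Or.inl h.ne')
  rw [h3]
  refine this.congr_deriv ?_
  ring

lemma hasDerivAt_radialW1 (r : ℝ) :
    HasDerivAt radialW1 (-(r * (15 - r ^ 2) / 18) * radialW r ^ 5) r := by
  have h1 : HasDerivAt (fun r : ℝ => (3 - r ^ 2) / 6) (-(2 * r) / 6) r := by
    have := ((hasDerivAt_pow 2 r).const_sub 3).div_const 6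
    simpa using this
  have := h1.mul ((hasDerivAt_radialW r).pow 3)
  refine this.congr_deriv ?_
  simp only [Nat.cast_ofNat, Pi.pow_apply]
  linear_combination (radialW r ^ 3 * r / 9) * radialW_sq r

lemma continuous_radialW : Continuous radialW :=
  continuous_iff_continuousAt.2 fun r => (hasDerivAt_radialW r).continuousAt

lemma deriv_radialW : deriv radialW = fun r => -(r / 3) * radialW r ^ 3 :=
  funext fun r => (hasDerivAt_radialW r).deriv

lemma deriv_radialW1 : deriv radialW1 = fun r => -(r * (15 - r ^ 2) / 18) * radialW r ^ 5 :=
  funext fun r => (hasDerivAt_radialW1 r).deriv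

lemma radialW_le_one (r : ℝ) : radialW r ≤ 1 := by
  nlinarith [radialW_sq r, radialW_pos r, mul_nonneg (sq_nonneg (radialW r)) (sq_nonneg r)]

lemma mul_radialW_le_two {r : ℝ} (hr : 0 ≤ r) : r * radialW r ≤ 2 := by
  have := radialW_sq r
  have h0 := mul_nonneg hr (radialW_pos r).le
  nlinarith [sq_nonneg (radialW r), sq_nonneg (r * radialW r)]

lemma mul_radialW_sq_le_one {r : ℝ} : r * radialW r ^ 2 ≤ 1 := by
  have := radialW_sq r
  have h0 := sq_nonneg (radialW r)
  nlinarith [mul_nonneg h0 (sq_nonneg (r - 3/2))]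

lemma tendsto_radialW_atTop : Filter.Tendsto radialW Filter.atTop (nhds 0) := by
  have h : Filter.Tendsto (fun r : ℝ => 2 / r) Filter.atTop (nhds 0) :=
    Filter.tendsto_id.const_div_atTop 2
  refine tendsto_of_tendsto_of_tendsto_of_le_of_le' tendsto_const_nhds h
    (Filter.Eventually.of_forall fun r => (radialW_pos r).le) ?_
  filter_upwards [Filter.eventually_gt_atTop 0] with r hr
  rw [le_div_iff₀ hr, mul_comm]
  exact mul_radialW_le_two hr.le

lemma abs_radialW1_le (r : ℝ) : |radialW1 r| ≤ radialW r := by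
  have h := radialW_sq r
  have hp := radialW_pos r
  have h3 : radialW r ^ 3 * (3 + r ^ 2) = 3 * radialW r := by linear_combination radialW r * h
  have h0 : 0 < radialW r ^ 3 := by positivity
  rw [radialW1, abs_le]
  constructor <;> nlinarith [mul_nonneg h0.le (sq_nonneg r)]

lemma tendsto_radialW1_atTop : Filter.Tendsto radialW1 Filter.atTop (nhds 0) :=
  squeeze_zero_norm abs_radialW1_le tendsto_radialW_atTop

/-! ### Radial functions of finite Dirichlet energy -/

/-- Profiles of radial functions in `Ḣ¹(ℝ³)` that are `C¹` and vanish at infinity. -/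
structure IsEnergyProfile (a : ℝ → ℝ) : Prop where
  contDiff : ContDiff ℝ 1 a
  integrableOn : IntegrableOn (fun r => r ^ 2 * deriv a r ^ 2) (Set.Ioi 0)
  tendsto : Filter.Tendsto a Filter.atTop (nhds 0)

/-- The Dirichlet form on radial profiles. -/
def dirichletForm (a b : ℝ → ℝ) : ℝ := ∫ r in Set.Ioi (0 : ℝ), r ^ 2 * (deriv a r * deriv b r)

/-- The `L²` form with weight `W⁴` on radial profiles. -/
def weightedForm (a b : ℝ → ℝ) : ℝ := ∫ r in Set.Ioi (0 : ℝ), r ^ 2 * radialW r ^ 4 * (a r * b r)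

lemma integrableOn_bounded_div {f : ℝ → ℝ} (C : ℝ) (hf : Continuous f)
    (h : ∀ r : ℝ, 0 < r → (1 + r ^ 2) * |f r| ≤ C) : IntegrableOn f (Set.Ioi 0) := by
  refine Integrable.mono' (g := fun r => C * (1 + r ^ 2)⁻¹)
    ((integrable_inv_one_add_sq.const_mul C).integrableOn) hf.aestronglyMeasurable ?_
  refine (ae_restrict_iff' measurableSet_Ioi).2 (Filter.Eventually.of_forall fun r hr => ?_)
  have := h r hr
  rw [Real.norm_eq_abs, ← div_eq_mul_inv, le_div_iff₀ (by positivity)]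
  linarith

lemma isEnergyProfile_radialW : IsEnergyProfile radialW := by
  refine ⟨contDiff_one_iff_deriv.2 ⟨fun r => (hasDerivAt_radialW r).differentiableAt, ?_⟩, ?_,
    tendsto_radialW_atTop⟩
  · rw [deriv_radialW]
    have := continuous_radialW
    fun_prop
  · rw [deriv_radialW]
    have := continuous_radialW
    refine integrableOn_bounded_div 9 (by fun_prop) fun r hr => ?_
    have h := radialW_sq r
    have hp := radialW_pos r
    rw [abs_of_nonneg (by positivity)]
    have e : r ^ 2 * (-(r / 3) * radialW r ^ 3) ^ 2 = (r ^ 2 * radialW r ^ 2) ^ 2 * radialW r ^ 2 / 9 := by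
      ring
    have h1 : r ^ 2 * radialW r ^ 2 ≤ 3 := by nlinarith [sq_nonneg (radialW r)]
    have h2 : (1 + r ^ 2) * radialW r ^ 2 ≤ 3 := by nlinarith [sq_nonneg (radialW r)]
    have h3 : (r ^ 2 * radialW r ^ 2) ^ 2 ≤ 9 := by
      have : 0 ≤ r ^ 2 * radialW r ^ 2 := by positivity
      nlinarith
    rw [e]
    have h4 : 0 ≤ (1 + r ^ 2) * radialW r ^ 2 := by positivity
    nlinarith [mul_le_mul h3 h2 h4 (by norm_num)]

lemma isEnergyProfile_radialW1 : IsEnergyProfile radialW1 := by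
  refine ⟨contDiff_one_iff_deriv.2 ⟨fun r => (hasDerivAt_radialW1 r).differentiableAt, ?_⟩, ?_,
    tendsto_radialW1_atTop⟩
  · rw [deriv_radialW1]
    have := continuous_radialW
    fun_prop
  · rw [deriv_radialW1]
    have := continuous_radialW
    refine integrableOn_bounded_div 100 (by fun_prop) fun r hr => ?_
    have h := radialW_sq r
    have hp := radialW_pos r
    rw [abs_of_nonneg (by positivity)]
    have e : r ^ 2 * (-(r * (15 - r ^ 2) / 18) * radialW r ^ 5) ^ 2
        = (r ^ 2 * radialW r ^ 2) ^ 2 * ((15 - r ^ 2) / 18 * radialW r ^ 2) ^ 2 * radialW r ^ 2 := by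
      ring
    have h1 : r ^ 2 * radialW r ^ 2 ≤ 3 := by nlinarith [sq_nonneg (radialW r)]
    have h2 : (1 + r ^ 2) * radialW r ^ 2 ≤ 3 := by nlinarith [sq_nonneg (radialW r)]
    have h3 : (r ^ 2 * radialW r ^ 2) ^ 2 ≤ 9 := by
      have : 0 ≤ r ^ 2 * radialW r ^ 2 := by positivity
      nlinarith
    have h5 : ((15 - r ^ 2) / 18 * radialW r ^ 2) ^ 2 ≤ 1 := by
      rw [sq_le_one_iff_abs_le_one, abs_le]
      have : 0 ≤ radialW r ^ 2 := by positivity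
      have : 0 ≤ r ^ 2 * radialW r ^ 2 := by positivity
      constructor <;> linarith
    have h6 : (r ^ 2 * radialW r ^ 2) ^ 2 * ((15 - r ^ 2) / 18 * radialW r ^ 2) ^ 2 ≤ 9 := by
      nlinarith [mul_le_mul h3 h5 (sq_nonneg _) (by norm_num)]
    rw [e]
    have h4 : 0 ≤ (1 + r ^ 2) * radialW r ^ 2 := by positivity
    nlinarith [mul_le_mul h6 h2 h4 (by norm_num)]

namespace IsEnergyProfile

variable {a b p : ℝ → ℝ}

lemma differentiable (ha : IsEnergyProfile a) : Differentiable ℝ a :=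
  ha.contDiff.differentiable one_ne_zero

lemma continuous (ha : IsEnergyProfile a) : Continuous a := ha.contDiff.continuous

lemma continuous_deriv (ha : IsEnergyProfile a) : Continuous (deriv a) :=
  (contDiff_one_iff_deriv.1 ha.contDiff).2

lemma integrableOn_mul (ha : IsEnergyProfile a) (hb : IsEnergyProfile b) :
    IntegrableOn (fun r => r ^ 2 * (deriv a r * deriv b r)) (Set.Ioi 0) := by
  have := ha.continuous_deriv
  have := hb.continuous_deriv
  refine Integrable.mono' (ha.integrableOn.add hb.integrableOn)
    (by fun_prop : Continuous _).aestronglyMeasurable (Filter.Eventually.of_forall fun r => ?_)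
  simp only [Pi.add_apply]
  rw [Real.norm_eq_abs, abs_mul, abs_of_nonneg (sq_nonneg r), ← mul_add]
  gcongr
  rw [abs_le]
  constructor <;> nlinarith [sq_nonneg (deriv a r - deriv b r), sq_nonneg (deriv a r + deriv b r),
    sq_nonneg (deriv a r), sq_nonneg (deriv b r)]

lemma deriv_sub_smul (ha : IsEnergyProfile a) (hp : IsEnergyProfile p) (c : ℝ) :
    deriv (fun r => a r - c * p r) = fun r => deriv a r - c * deriv p r := by
  funext r
  exact ((ha.differentiable r).hasDerivAt.sub ((hp.differentiable r).hasDerivAt.const_mul c)).deriv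

lemma sub_smul (ha : IsEnergyProfile a) (hp : IsEnergyProfile p) (c : ℝ) :
    IsEnergyProfile (fun r => a r - c * p r) := by
  refine ⟨ha.contDiff.sub (contDiff_const.mul hp.contDiff), ?_, ?_⟩
  · rw [ha.deriv_sub_smul hp]
    have := ((ha.integrableOn.sub ((ha.integrableOn_mul hp).const_mul (2 * c)))).add
      (hp.integrableOn.const_mul (c ^ 2))
    refine this.congr (Filter.Eventually.of_forall fun r => ?_)
    simp only [Pi.add_apply, Pi.sub_apply]
    ring
  · simpa using ha.tendsto.sub (hp.tendsto.const_mul c)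

lemma two_mul_le (ha : IsEnergyProfile a) {r R k : ℝ} (hr : 0 < r) (hR : r ≤ R) :
    2 * k * (a r - a R) ≤ (∫ s in r..R, s ^ 2 * deriv a s ^ 2) + k ^ 2 / r := by
  have hc := ha.continuous_deriv
  have h := intervalIntegral.sub_le_integral_of_hasDeriv_right_of_le (a := r) (b := R)
    (g := fun s => -(2 * k) * a s + k ^ 2 / s) (g' := fun s => -(2 * k) * deriv a s + -(k ^ 2) / s ^ 2)
    (φ := fun s => s ^ 2 * deriv a s ^ 2) hR ?_ ?_ ?_ ?_
  · have : 0 ≤ k ^ 2 / R := by have := hr.trans_le hR; positivity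
    linarith
  · have := ha.continuous
    refine ContinuousOn.add (by fun_prop) (continuousOn_const.div continuousOn_id fun s hs => ?_)
    exact (hr.trans_le hs.1).ne'
  · intro s hs
    have hs0 : s ≠ 0 := (hr.trans hs.1).ne'
    have := ((ha.differentiable s).hasDerivAt.const_mul (-(2 * k))).add
      ((hasDerivAt_inv hs0).const_mul (k ^ 2))
    refine HasDerivAt.hasDerivWithinAt (this.congr_deriv ?_)
    ring
  · exact (by fun_prop : Continuous _).integrableOn_Icc
  · intro s hs
    have hs0 : 0 < s := (hr.trans hs.1)
    have : s ^ 2 * deriv a s ^ 2 - (-(2 * k) * deriv a s + -(k ^ 2) / s ^ 2)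
        = (s * deriv a s + k / s) ^ 2 := by
      field_simp
      ring
    nlinarith [sq_nonneg (s * deriv a s + k / s)]

lemma mul_sq_le_tail (ha : IsEnergyProfile a) {r : ℝ} (hr : 0 < r) :
    r * a r ^ 2 ≤ dirichletForm a a - ∫ s in (0 : ℝ)..r, s ^ 2 * deriv a s ^ 2 := by
  have hc := ha.continuous_deriv
  have hi : ∀ x y : ℝ, IntervalIntegrable (fun s => s ^ 2 * deriv a s ^ 2) volume x y := fun x y =>
    (by fun_prop : Continuous _).intervalIntegrable _ _
  have hD : dirichletForm a a = ∫ s in Set.Ioi 0, s ^ 2 * deriv a s ^ 2 := by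
    simp only [dirichletForm, pow_two]
  have h1 : Filter.Tendsto (fun R => 2 * (r * a r) * (a r - a R)) Filter.atTop
      (nhds (2 * (r * a r) * (a r - 0))) := (ha.tendsto.const_sub _).const_mul _
  have h2 : Filter.Tendsto (fun R => (∫ s in (0 : ℝ)..R, s ^ 2 * deriv a s ^ 2)
      - (∫ s in (0 : ℝ)..r, s ^ 2 * deriv a s ^ 2) + (r * a r) ^ 2 / r) Filter.atTop
      (nhds (dirichletForm a a - (∫ s in (0 : ℝ)..r, s ^ 2 * deriv a s ^ 2) + (r * a r) ^ 2 / r)) := by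
    rw [hD]
    exact ((intervalIntegral_tendsto_integral_Ioi 0 ha.integrableOn Filter.tendsto_id).sub_const
      _).add_const _
  have h3 := le_of_tendsto_of_tendsto h1 h2 (by
    filter_upwards [Filter.eventually_ge_atTop r] with R hR
    have := ha.two_mul_le (k := r * a r) hr hR
    rwa [← intervalIntegral.integral_interval_sub_left (hi 0 R) (hi 0 r)] at this)
  have e : (r * a r) ^ 2 / r = r * a r ^ 2 := by field_simp
  rw [e] at h3
  linarith

lemma mul_sq_le (ha : IsEnergyProfile a) {r : ℝ} (hr : 0 < r) :
    r * a r ^ 2 ≤ dirichletForm a a := by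
  have := ha.mul_sq_le_tail hr
  have : 0 ≤ ∫ s in (0 : ℝ)..r, s ^ 2 * deriv a s ^ 2 :=
    intervalIntegral.integral_nonneg hr.le fun s _ => by positivity
  linarith

lemma tendsto_mul_sq (ha : IsEnergyProfile a) :
    Filter.Tendsto (fun r => r * a r ^ 2) Filter.atTop (nhds 0) := by
  have hD : dirichletForm a a = ∫ s in Set.Ioi 0, s ^ 2 * deriv a s ^ 2 := by
    simp only [dirichletForm, pow_two]
  have h := (intervalIntegral_tendsto_integral_Ioi 0 ha.integrableOn Filter.tendsto_id).const_sub
    (dirichletForm a a)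
  rw [← hD, sub_self] at h
  refine tendsto_of_tendsto_of_tendsto_of_le_of_le' tendsto_const_nhds h ?_ ?_
  · filter_upwards [Filter.eventually_gt_atTop 0] with r hr
    positivity
  · filter_upwards [Filter.eventually_gt_atTop 0] with r hr
    exact ha.mul_sq_le_tail hr

lemma intervalIntegral_sq_le (ha : IsEnergyProfile a) {R : ℝ} (hR : 0 < R) :
    ∫ r in (0 : ℝ)..R, a r ^ 2 ≤ 6 * dirichletForm a a := by
  have hc := ha.continuous_deriv
  have hc' := ha.continuous
  have hD : dirichletForm a a = ∫ s in Set.Ioi 0, s ^ 2 * deriv a s ^ 2 := by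
    simp only [dirichletForm, pow_two]
  have hle : ∫ r in (0 : ℝ)..R, r ^ 2 * deriv a r ^ 2 ≤ dirichletForm a a := by
    rw [hD, intervalIntegral.integral_of_le hR.le]
    exact setIntegral_mono_set ha.integrableOn (Filter.Eventually.of_forall fun r => by positivity)
      (Set.Ioc_subset_Ioi_self.eventuallyLE)
  have h := intervalIntegral.sub_le_integral_of_hasDeriv_right_of_le (a := 0) (b := R)
    (g := fun s => -2 * (s * a s ^ 2)) (g' := fun s => -2 * (a s ^ 2 + s * (2 * a s * deriv a s)))
    (φ := fun s => 4 * (s ^ 2 * deriv a s ^ 2) - a s ^ 2) hR.le (by fun_prop) ?_ ?_ ?_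
  · rw [intervalIntegral.integral_sub ((by fun_prop : Continuous _).intervalIntegrable _ _)
      ((by fun_prop : Continuous _).intervalIntegrable _ _),
      intervalIntegral.integral_const_mul] at h
    have := ha.mul_sq_le hR
    norm_num at h
    linarith
  · intro s _
    have := (((hasDerivAt_id s).mul ((ha.differentiable s).hasDerivAt.pow 2))).const_mul (-2)
    refine HasDerivAt.hasDerivWithinAt (this.congr_deriv ?_)
    simp
  · exact (by fun_prop : Continuous _).integrableOn_Icc
  · intro s _
    nlinarith [sq_nonneg (2 * s * deriv a s + a s)]

lemma integrableOn_sq (ha : IsEnergyProfile a) :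
    IntegrableOn (fun r => a r ^ 2) (Set.Ioi 0) := by
  have hc' := ha.continuous
  refine integrableOn_Ioi_of_intervalIntegral_norm_bounded (6 * dirichletForm a a) 0
    (b := fun R : ℝ => R) (fun R => ?_) Filter.tendsto_id ?_
  · exact ((by fun_prop : Continuous _).integrableOn_Icc).mono_set Set.Ioc_subset_Icc_self
  · filter_upwards [Filter.eventually_gt_atTop 0] with R hR
    simpa using ha.intervalIntegral_sq_le hR

/-- Hardy's inequality. -/
lemma integral_sq_le (ha : IsEnergyProfile a) :
    ∫ r in Set.Ioi (0 : ℝ), a r ^ 2 ≤ 6 * dirichletForm a a := by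
  refine le_of_tendsto (intervalIntegral_tendsto_integral_Ioi 0 ha.integrableOn_sq
    Filter.tendsto_id) ?_
  filter_upwards [Filter.eventually_gt_atTop 0] with R hR
  exact ha.intervalIntegral_sq_le hR

lemma integrableOn_weighted (ha : IsEnergyProfile a) (hb : IsEnergyProfile b) :
    IntegrableOn (fun r => r ^ 2 * radialW r ^ 4 * (a r * b r)) (Set.Ioi 0) := by
  have := ha.continuous
  have := hb.continuous
  have := continuous_radialW
  refine Integrable.mono' (ha.integrableOn_sq.add hb.integrableOn_sq)
    (by fun_prop : Continuous _).aestronglyMeasurable ?_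
  refine (ae_restrict_iff' measurableSet_Ioi).2 (Filter.Eventually.of_forall fun r hr => ?_)
  have hr : 0 < r := hr
  have h1 : r ^ 2 * radialW r ^ 4 ≤ 1 := by
    have h := mul_radialW_sq_le_one (r := r)
    have h0 : 0 ≤ r * radialW r ^ 2 := by positivity
    nlinarith
  have h2 : |a r * b r| ≤ a r ^ 2 + b r ^ 2 := by
    rw [abs_le]
    constructor <;> nlinarith [sq_nonneg (a r - b r), sq_nonneg (a r + b r)]
  rw [Real.norm_eq_abs, abs_mul, abs_of_nonneg (by positivity : 0 ≤ r ^ 2 * radialW r ^ 4)]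
  simp only [Pi.add_apply]
  nlinarith [abs_nonneg (a r * b r)]

lemma dirichletForm_sub_smul_left (ha : IsEnergyProfile a) (hp : IsEnergyProfile p)
    (hb : IsEnergyProfile b) (c : ℝ) :
    dirichletForm (fun r => a r - c * p r) b = dirichletForm a b - c * dirichletForm p b := by
  simp only [dirichletForm]
  rw [ha.deriv_sub_smul hp, ← integral_const_mul,
    ← integral_sub (ha.integrableOn_mul hb) ((hp.integrableOn_mul hb).const_mul c)]
  congr 1
  funext r
  ring

lemma weightedForm_sub_smul_left (ha : IsEnergyProfile a) (hp : IsEnergyProfile p)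
    (hb : IsEnergyProfile b) (c : ℝ) :
    weightedForm (fun r => a r - c * p r) b = weightedForm a b - c * weightedForm p b := by
  simp only [weightedForm]
  rw [← integral_const_mul,
    ← integral_sub (ha.integrableOn_weighted hb) ((hp.integrableOn_weighted hb).const_mul c)]
  congr 1
  funext r
  ring

end IsEnergyProfile

lemma dirichletForm_comm (a b : ℝ → ℝ) : dirichletForm a b = dirichletForm b a := by
  simp only [dirichletForm, mul_comm (deriv a _)]

lemma weightedForm_comm (a b : ℝ → ℝ) : weightedForm a b = weightedForm b a := by
  simp only [weightedForm, mul_comm (a _)]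

lemma dirichletForm_self_nonneg (a : ℝ → ℝ) : 0 ≤ dirichletForm a a :=
  setIntegral_nonneg measurableSet_Ioi fun r _ =>
    mul_nonneg (sq_nonneg r) (mul_self_nonneg _)

lemma weightedForm_self_nonneg (a : ℝ → ℝ) : 0 ≤ weightedForm a a :=
  setIntegral_nonneg measurableSet_Ioi fun r _ =>
    mul_nonneg (mul_nonneg (sq_nonneg r) (by positivity)) (mul_self_nonneg _)

lemma IsEnergyProfile.dirichletForm_sub_smul_self {a p : ℝ → ℝ} (ha : IsEnergyProfile a)
    (hp : IsEnergyProfile p) (c : ℝ) :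
    dirichletForm (fun r => a r - c * p r) (fun r => a r - c * p r)
      = dirichletForm a a - 2 * c * dirichletForm a p + c ^ 2 * dirichletForm p p := by
  rw [ha.dirichletForm_sub_smul_left hp (ha.sub_smul hp c), dirichletForm_comm a,
    dirichletForm_comm p, ha.dirichletForm_sub_smul_left hp ha,
    ha.dirichletForm_sub_smul_left hp hp, dirichletForm_comm p a]
  ring

lemma IsEnergyProfile.weightedForm_sub_smul_self {a p : ℝ → ℝ} (ha : IsEnergyProfile a)
    (hp : IsEnergyProfile p) (c : ℝ) :
    weightedForm (fun r => a r - c * p r) (fun r => a r - c * p r)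
      = weightedForm a a - 2 * c * weightedForm a p + c ^ 2 * weightedForm p p := by
  rw [ha.weightedForm_sub_smul_left hp (ha.sub_smul hp c), weightedForm_comm a,
    weightedForm_comm p, ha.weightedForm_sub_smul_left hp ha,
    ha.weightedForm_sub_smul_left hp hp, weightedForm_comm p a]
  ring


/-! ### Green's identity against the two explicit eigenfunctions -/

lemma IsEnergyProfile.dirichletForm_eq_mul_weightedForm {p a P : ℝ → ℝ} {l C : ℝ}
    (hp : IsEnergyProfile p) (ha : IsEnergyProfile a) (hP : ∀ r, P r = r ^ 2 * deriv p r)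
    (hd : ∀ r, HasDerivAt P (-l * (r ^ 2 * radialW r ^ 4 * p r)) r)
    (hC : ∀ r : ℝ, 0 < r → |P r| ≤ C) :
    dirichletForm p a = l * weightedForm p a := by
  have h1 := hp.integrableOn_mul ha
  have h2 := (hp.integrableOn_weighted ha).const_mul l
  have h := integral_Ioi_of_hasDerivAt_of_tendsto' (a := 0) (m := 0) (f := fun r => P r * a r)
    (f' := fun r => r ^ 2 * (deriv p r * deriv a r) - l * (r ^ 2 * radialW r ^ 4 * (p r * a r)))
    (fun r _ => ?_) (h1.sub h2) ?_
  · rw [integral_sub h1 h2, integral_const_mul, hP 0] at h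
    simp only [dirichletForm, weightedForm]
    linarith
  · refine ((hd r).mul (ha.differentiable r).hasDerivAt).congr_deriv ?_
    rw [hP]
    ring
  · refine squeeze_zero_norm' (a := fun r => C * |a r|) ?_ ?_
    · filter_upwards [Filter.eventually_gt_atTop 0] with r hr
      rw [norm_mul, Real.norm_eq_abs, Real.norm_eq_abs]
      exact mul_le_mul_of_nonneg_right (hC r hr) (abs_nonneg _)
    · simpa using ha.tendsto.abs.const_mul C

lemma dirichletForm_radialW {a : ℝ → ℝ} (ha : IsEnergyProfile a) :
    dirichletForm radialW a = 1 * weightedForm radialW a := by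
  refine isEnergyProfile_radialW.dirichletForm_eq_mul_weightedForm ha
    (P := fun r => -(r ^ 3 / 3) * radialW r ^ 3) (C := 8) (fun r => ?_) (fun r => ?_) fun r hr => ?_
  · rw [deriv_radialW]
    ring
  · refine ((((hasDerivAt_pow 3 r).div_const 3).neg).mul
      ((hasDerivAt_radialW r).pow 3)).congr_deriv ?_
    simp only [Nat.cast_ofNat, Pi.pow_apply, Pi.neg_apply]
    linear_combination (radialW r ^ 3 * r ^ 2 / 3) * radialW_sq r
  · have h := mul_radialW_le_two hr.le
    have h0 : 0 ≤ r * radialW r := mul_nonneg hr.le (radialW_pos r).le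
    have e : -(r ^ 3 / 3) * radialW r ^ 3 = -((r * radialW r) ^ 3 / 3) := by ring
    rw [e, abs_neg, abs_of_nonneg (by positivity)]
    have := pow_le_pow_left₀ h0 h 3
    linarith

lemma dirichletForm_radialW1 {a : ℝ → ℝ} (ha : IsEnergyProfile a) :
    dirichletForm radialW1 a = 5 * weightedForm radialW1 a := by
  refine isEnergyProfile_radialW1.dirichletForm_eq_mul_weightedForm ha
    (P := fun r => -((15 * r ^ 3 - r ^ 5) / 18) * radialW r ^ 5) (C := 10)
    (fun r => ?_) (fun r => ?_) fun r hr => ?_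
  · rw [deriv_radialW1]
    ring
  · refine ((((((hasDerivAt_pow 3 r).const_mul 15).sub (hasDerivAt_pow 5 r)).div_const 18).neg).mul
      ((hasDerivAt_radialW r).pow 5)).congr_deriv ?_
    simp only [Nat.cast_ofNat, Pi.pow_apply, Pi.neg_apply, Pi.sub_apply, radialW1]
    linear_combination (radialW r ^ 5 * (45 * r ^ 2 - 5 * r ^ 4) / 54) * radialW_sq r
  · have h := mul_radialW_le_two hr.le
    have hp := radialW_pos r
    have h0 : 0 ≤ r * radialW r := mul_nonneg hr.le hp.le
    have h1 := pow_le_pow_left₀ h0 h 5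
    have h2 := pow_le_pow_left₀ h0 h 3
    have h3 : radialW r ^ 2 ≤ 1 := pow_le_one₀ hp.le (radialW_le_one r)
    have h4 : (r * radialW r) ^ 3 * radialW r ^ 2 ≤ 8 := by
      nlinarith [mul_le_mul h2 h3 (by positivity) (by norm_num)]
    have h5 : 0 ≤ (r * radialW r) ^ 3 * radialW r ^ 2 := by positivity
    have h6 : 0 ≤ (r * radialW r) ^ 5 := by positivity
    have e : -((15 * r ^ 3 - r ^ 5) / 18) * radialW r ^ 5
      = (r * radialW r) ^ 5 / 18 - 15 / 18 * ((r * radialW r) ^ 3 * radialW r ^ 2) := by ring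
    rw [e, abs_le]
    constructor <;> linarith

lemma dirichletForm_radialW1_radialW : dirichletForm radialW1 radialW = 0 := by
  have h1 := dirichletForm_radialW1 isEnergyProfile_radialW
  have h2 := dirichletForm_radialW isEnergyProfile_radialW1
  rw [dirichletForm_comm, weightedForm_comm] at h2
  linarith

lemma dirichletForm_radialW_pos : 0 < dirichletForm radialW radialW := by
  have h := isEnergyProfile_radialW.mul_sq_le (r := 1) one_pos
  have := radialW_pos 1
  have : 0 < 1 * radialW 1 ^ 2 := by positivity
  linarith

/-! ### Coercivity -/

lemma continuous_sq_div_sub {a : ℝ → ℝ} (ha : Differentiable ℝ a) {x : ℝ} (hx : a x = 0) :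
    Continuous fun r => a r ^ 2 / (r - x) := by
  have hd : Continuous (dslope a x) := by
    have := (continuousOn_dslope (f := a) (a := x) (s := Set.univ) Filter.univ_mem).2
      ⟨ha.continuous.continuousOn, ha x⟩
    rwa [← continuousOn_univ]
  have e : (fun r => a r ^ 2 / (r - x)) = fun r => (r - x) * dslope a x r ^ 2 := by
    funext r
    have h := sub_smul_dslope a x r
    rw [hx, sub_zero, smul_eq_mul] at h
    rw [← h]
    rcases eq_or_ne r x with rfl | hr
    · simp
    · have : r - x ≠ 0 := sub_ne_zero.2 hr
      field_simp
  rw [e]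
  fun_prop

/-- The function `picone a` is `r² (φ' / φ) a²`, where `φ` is the radial eigenfunction of
`-Δ φ = (35 / 3) W⁴ φ`, which vanishes exactly at `r = 1` and `r = 3`. -/
def picone (a : ℝ → ℝ) (r : ℝ) : ℝ :=
  r ^ 3 * (-5 / (3 + r ^ 2)) * a r ^ 2 + 2 * r ^ 3 / (r + 1) * (a r ^ 2 / (r - 1))
    + 2 * r ^ 3 / (r + 3) * (a r ^ 2 / (r - 3))

lemma continuousOn_picone {a : ℝ → ℝ} (ha : Differentiable ℝ a) (h1 : a 1 = 0) (h3 : a 3 = 0) :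
    ContinuousOn (picone a) (Set.Ici 0) := by
  have c1 := continuous_sq_div_sub ha h1
  have c3 := continuous_sq_div_sub ha h3
  have c := ha.continuous
  unfold picone
  refine ContinuousOn.add (ContinuousOn.add (ContinuousOn.mul (ContinuousOn.mul (by fun_prop)
    (ContinuousOn.div (by fun_prop) (by fun_prop) fun r _ => ?_)) (by fun_prop))
    (ContinuousOn.mul (ContinuousOn.div (by fun_prop) (by fun_prop) fun r hr => ?_)
      c1.continuousOn))
    (ContinuousOn.mul (ContinuousOn.div (by fun_prop) (by fun_prop) fun r hr => ?_)
      c3.continuousOn)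
  · positivity
  · have : (0 : ℝ) ≤ r := hr
    positivity
  · have : (0 : ℝ) ≤ r := hr
    positivity

lemma hasDerivAt_picone {a : ℝ → ℝ} (ha : Differentiable ℝ a) {r : ℝ} (hr : 0 < r) (h1 : r ≠ 1)
    (h3 : r ≠ 3) :
    ∃ d, HasDerivAt (picone a) d r ∧
      d ≤ r ^ 2 * deriv a r ^ 2 - 35 / 3 * (r ^ 2 * radialW r ^ 4 * (a r * a r)) := by
  have n0 : 3 + r ^ 2 ≠ 0 := by positivity
  have n1 : r + 1 ≠ 0 := by positivity
  have n2 : r + 3 ≠ 0 := by positivity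
  have n3 : r - 1 ≠ 0 := sub_ne_zero.2 h1
  have n4 : r - 3 ≠ 0 := sub_ne_zero.2 h3
  set q : ℝ := -5 / (3 + r ^ 2) + 2 / (r + 1) / (r - 1) + 2 / (r + 3) / (r - 3) with hq
  set q' : ℝ := 5 * (2 * r) / (3 + r ^ 2) ^ 2 - 2 * (2 * r) / (r ^ 2 - 1) ^ 2
    - 2 * (2 * r) / (r ^ 2 - 9) ^ 2 with hq'
  have n5 : r ^ 2 - 1 ≠ 0 := by
    have : r ^ 2 - 1 = (r - 1) * (r + 1) := by ring
    rw [this]; positivity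
  have n6 : r ^ 2 - 9 ≠ 0 := by
    have : r ^ 2 - 9 = (r - 3) * (r + 3) := by ring
    rw [this]; positivity
  have e : picone a = fun s => s ^ 3 * (-5 * (3 + s ^ 2)⁻¹ + 2 * (s ^ 2 - 1)⁻¹ + 2 * (s ^ 2 - 9)⁻¹)
      * a s ^ 2 := by
    funext s
    have e1 : (s ^ 2 - 1)⁻¹ = (s + 1)⁻¹ * (s - 1)⁻¹ := by rw [← mul_inv]; ring_nf
    have e2 : (s ^ 2 - 9)⁻¹ = (s + 3)⁻¹ * (s - 3)⁻¹ := by rw [← mul_inv]; ring_nf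
    rw [e1, e2, picone]
    ring
  have hw : radialW r ^ 4 = 9 / (3 + r ^ 2) ^ 2 := by
    rw [eq_div_iff (by positivity)]
    linear_combination (radialW r ^ 2 * (3 + r ^ 2) + 3) * radialW_sq r
  have hsq := hasDerivAt_pow 2 r
  have d0 := ((hsq.const_add 3).fun_inv n0).const_mul (-5)
  have d1 := ((hsq.sub_const 1).fun_inv n5).const_mul 2
  have d2 := ((hsq.sub_const 9).fun_inv n6).const_mul 2
  have D := ((hasDerivAt_pow 3 r).mul ((d0.add d1).add d2)).mul ((ha r).hasDerivAt.pow 2)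
  have hqq : q = -5 * (3 + r ^ 2)⁻¹ + 2 * (r ^ 2 - 1)⁻¹ + 2 * (r ^ 2 - 9)⁻¹ := by
    have e1 : (r ^ 2 - 1)⁻¹ = (r + 1)⁻¹ * (r - 1)⁻¹ := by rw [← mul_inv]; ring_nf
    have e2 : (r ^ 2 - 9)⁻¹ = (r + 3)⁻¹ * (r - 3)⁻¹ := by rw [← mul_inv]; ring_nf
    rw [e1, e2, hq]
    ring
  have D2 : HasDerivAt (picone a)
      ((3 * r ^ 2 * q + r ^ 3 * q') * a r ^ 2 + r ^ 3 * q * (2 * a r * deriv a r)) r := by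
    rw [e]
    refine D.congr_deriv ?_
    simp only [Pi.add_apply, Pi.mul_apply, Pi.pow_apply, Nat.cast_ofNat, hqq, hq']
    ring
  refine ⟨_, D2, ?_⟩
  have key : 3 * r ^ 2 * q + r ^ 3 * q' + r ^ 4 * q ^ 2 = -(35 / 3) * (r ^ 2 * radialW r ^ 4) := by
    rw [hw, hqq, hq']
    field_simp
    ring
  have : r ^ 2 * deriv a r ^ 2 - 35 / 3 * (r ^ 2 * radialW r ^ 4 * (a r * a r))
      - ((3 * r ^ 2 * q + r ^ 3 * q') * a r ^ 2 + r ^ 3 * q * (2 * a r * deriv a r))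
      = (r * deriv a r - r ^ 2 * q * a r) ^ 2 := by
    linear_combination (-a r ^ 2) * key
  nlinarith [sq_nonneg (r * deriv a r - r ^ 2 * q * a r)]

lemma IsEnergyProfile.picone_sub_le {a : ℝ → ℝ} (ha : IsEnergyProfile a) (h1 : a 1 = 0)
    (h3 : a 3 = 0) {x y : ℝ} (hx : 0 ≤ x) (hxy : x ≤ y) (hn1 : 1 ∉ Set.Ioo x y)
    (hn3 : 3 ∉ Set.Ioo x y) :
    picone a y - picone a x ≤ ∫ r in x..y,
      (r ^ 2 * deriv a r ^ 2 - 35 / 3 * (r ^ 2 * radialW r ^ 4 * (a r * a r))) := by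
  have c := ha.continuous
  have c' := ha.continuous_deriv
  have cw := continuous_radialW
  refine intervalIntegral.sub_le_integral_of_hasDeriv_right_of_le (g' := deriv (picone a)) hxy
    ((continuousOn_picone ha.differentiable h1 h3).mono fun r hr => hx.trans hr.1) ?_
    (by fun_prop : Continuous _).integrableOn_Icc ?_
  · intro r hr
    obtain ⟨d, hd, -⟩ := hasDerivAt_picone ha.differentiable (hx.trans_lt hr.1)
      (fun h => hn1 (h ▸ hr)) (fun h => hn3 (h ▸ hr))
    exact hd.differentiableAt.hasDerivAt.hasDerivWithinAt
  · intro r hr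
    obtain ⟨d, hd, hle⟩ := hasDerivAt_picone ha.differentiable (hx.trans_lt hr.1)
      (fun h => hn1 (h ▸ hr)) (fun h => hn3 (h ▸ hr))
    rwa [hd.deriv]

lemma IsEnergyProfile.tendsto_picone {a : ℝ → ℝ} (ha : IsEnergyProfile a) :
    Filter.Tendsto (picone a) Filter.atTop (nhds 0) := by
  refine squeeze_zero_norm' (a := fun r => 12 * (r * a r ^ 2)) ?_
    (by simpa using ha.tendsto_mul_sq.const_mul 12)
  filter_upwards [Filter.eventually_ge_atTop 4] with r hr
  have n1 : 0 < r - 1 := by linarith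
  have n3 : 0 < r - 3 := by linarith
  have hr0 : 0 < r := by linarith
  have hs : 0 ≤ r * a r ^ 2 := by positivity
  have e : picone a r = (r ^ 2 * (2 / ((r + 1) * (r - 1)) + 2 / ((r + 3) * (r - 3)) - 5 / (3 + r ^ 2)))
      * (r * a r ^ 2) := by
    rw [picone]
    field_simp
    ring
  rw [e, norm_mul, Real.norm_eq_abs, Real.norm_eq_abs, abs_of_nonneg hs]
  refine mul_le_mul_of_nonneg_right ?_ hs
  have b1 : r ^ 2 * (2 / ((r + 1) * (r - 1))) ≤ 3 := by
    rw [← mul_div_assoc, div_le_iff₀ (by positivity)]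
    nlinarith
  have b2 : r ^ 2 * (2 / ((r + 3) * (r - 3))) ≤ 6 := by
    rw [← mul_div_assoc, div_le_iff₀ (by positivity)]
    nlinarith
  have b3 : r ^ 2 * (5 / (3 + r ^ 2)) ≤ 5 := by
    rw [← mul_div_assoc, div_le_iff₀ (by positivity)]
    nlinarith
  have p1 : 0 ≤ r ^ 2 * (2 / ((r + 1) * (r - 1))) := by positivity
  have p2 : 0 ≤ r ^ 2 * (2 / ((r + 3) * (r - 3))) := by positivity
  have p3 : 0 ≤ r ^ 2 * (5 / (3 + r ^ 2)) := by positivity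
  rw [abs_le]
  constructor <;> nlinarith

/-- The form `D - (35 / 3) M` is nonnegative on profiles vanishing at the two nodes of the third
radial eigenfunction. -/
lemma IsEnergyProfile.weightedForm_le_of_zeros {a : ℝ → ℝ} (ha : IsEnergyProfile a) (h1 : a 1 = 0)
    (h3 : a 3 = 0) : 35 / 3 * weightedForm a a ≤ dirichletForm a a := by
  have c := ha.continuous
  have c' := ha.continuous_deriv
  have cw := continuous_radialW
  have hi : ∀ x y : ℝ, IntervalIntegrable (fun r => r ^ 2 * deriv a r ^ 2
      - 35 / 3 * (r ^ 2 * radialW r ^ 4 * (a r * a r))) volume x y := fun x y =>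
    (by fun_prop : Continuous _).intervalIntegrable _ _
  have hint := (ha.integrableOn_weighted ha).const_mul (35 / 3)
  have hlim := intervalIntegral_tendsto_integral_Ioi 0 (ha.integrableOn.sub hint) Filter.tendsto_id
  have hge := le_of_tendsto_of_tendsto ha.tendsto_picone hlim (by
    filter_upwards [Filter.eventually_ge_atTop 3] with R hR
    have i1 := ha.picone_sub_le h1 h3 (x := 0) (y := 1) le_rfl zero_le_one
      (by simp) (by norm_num)
    have i2 := ha.picone_sub_le h1 h3 (x := 1) (y := 3) zero_le_one (by norm_num)
      (by simp) (by simp)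
    have i3 := ha.picone_sub_le h1 h3 (x := 3) (y := R) (by norm_num) hR
      (by norm_num) (by simp)
    have e0 : picone a 0 = 0 := by simp [picone]
    have e := intervalIntegral.integral_add_adjacent_intervals (hi 0 1) (hi 1 3)
    have e' := intervalIntegral.integral_add_adjacent_intervals (hi 0 3) (hi 3 R)
    simp only [id, Pi.sub_apply]
    linarith)
  simp only [Pi.sub_apply] at hge
  rw [integral_sub ha.integrableOn hint, integral_const_mul] at hge
  have hD : dirichletForm a a = ∫ s in Set.Ioi 0, s ^ 2 * deriv a s ^ 2 := by
    simp only [dirichletForm, pow_two]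
  rw [hD, weightedForm]
  linarith

/-- Spectral gap above the two explicit eigenfunctions. -/
lemma IsEnergyProfile.weightedForm_le_of_orthogonal {a : ℝ → ℝ} (ha : IsEnergyProfile a)
    (hw : dirichletForm a radialW = 0) (hw1 : dirichletForm a radialW1 = 0) :
    35 / 3 * weightedForm a a ≤ dirichletForm a a := by
  have HW := isEnergyProfile_radialW
  have HW1 := isEnergyProfile_radialW1
  have p1 := radialW_pos 1
  have p3 := radialW_pos 3
  have s1 := radialW_sq 1
  have s3 := radialW_sq 3
  set A := a 1 / radialW 1 with hA
  set B := a 3 / radialW 3 with hB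
  have hA' : a 1 = A * radialW 1 := by rw [hA]; field_simp
  have hB' : a 3 = B * radialW 3 := by rw [hB]; field_simp
  set b := (A + B) / 2 with hb
  set c := 2 * (A - B) with hc
  have ha1 := ha.sub_smul HW b
  have ha2 := ha1.sub_smul HW1 c
  have h := ha2.weightedForm_le_of_zeros ?_ ?_
  · have MW := dirichletForm_radialW ha
    have MW1 := dirichletForm_radialW1 ha
    rw [dirichletForm_comm, weightedForm_comm] at MW MW1
    have MWW := dirichletForm_radialW HW
    have MW1W1 := dirichletForm_radialW1 HW1
    have MW1W := dirichletForm_radialW1 HW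
    have o := dirichletForm_radialW1_radialW
    rw [ha1.weightedForm_sub_smul_self HW1, ha1.dirichletForm_sub_smul_self HW1,
      ha.weightedForm_sub_smul_self HW, ha.dirichletForm_sub_smul_self HW,
      ha.dirichletForm_sub_smul_left HW HW1, ha.weightedForm_sub_smul_left HW HW1,
      dirichletForm_comm radialW radialW1, weightedForm_comm radialW radialW1, hw, hw1, o] at h
    have e1 : weightedForm a radialW = 0 := by linarith
    have e2 : weightedForm a radialW1 = 0 := by linarith
    have e3 : weightedForm radialW1 radialW = 0 := by linarith
    rw [e1, e2, e3] at h
    have k0 := weightedForm_self_nonneg radialW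
    have k1 := weightedForm_self_nonneg radialW1
    rw [MWW, MW1W1] at h
    nlinarith [mul_nonneg (sq_nonneg b) k0, mul_nonneg (sq_nonneg c) k1]
  · simp only [radialW1, hA', hb, hc]
    linear_combination (-(radialW 1) * (A - B) / 6) * s1
  · simp only [radialW1, hB', hb, hc]
    linear_combination ((radialW 3) * (A - B) / 6) * s3

lemma IsEnergyProfile.weightedForm_le_of_orthogonal_radialW {a : ℝ → ℝ} (ha : IsEnergyProfile a)
    (hw : dirichletForm a radialW = 0) : 5 * weightedForm a a ≤ dirichletForm a a := by
  have HW := isEnergyProfile_radialW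
  have HW1 := isEnergyProfile_radialW1
  have o := dirichletForm_radialW1_radialW
  have K1 : 0 < dirichletForm radialW1 radialW1 := by
    have h := HW1.mul_sq_le (r := 1) one_pos
    have := radialW_pos 1
    have : 0 < 1 * radialW1 1 ^ 2 := by rw [radialW1]; positivity
    linarith
  set d := dirichletForm a radialW1 / dirichletForm radialW1 radialW1 with hd
  have hd' : dirichletForm a radialW1 = d * dirichletForm radialW1 radialW1 := by
    rw [hd]; field_simp
  have h := (ha.sub_smul HW1 d).weightedForm_le_of_orthogonal ?_ ?_
  · have MW1 := dirichletForm_radialW1 ha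
    have MW1W1 := dirichletForm_radialW1 HW1
    rw [dirichletForm_comm, weightedForm_comm] at MW1
    have h0 := weightedForm_self_nonneg (fun r => a r - d * radialW1 r)
    rw [ha.weightedForm_sub_smul_self HW1] at h h0
    rw [ha.dirichletForm_sub_smul_self HW1] at h
    rw [MW1W1] at hd' h
    rw [hd'] at MW1 h
    have e : weightedForm a radialW1 = d * weightedForm radialW1 radialW1 := by linarith
    rw [e] at h h0
    nlinarith
  · rw [ha.dirichletForm_sub_smul_left HW1 HW, hw, o]
    ring
  · rw [ha.dirichletForm_sub_smul_left HW1 HW1, hd']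
    ring


/-! ### Expansion of the energy at the ground state -/

/-- Remainder of the quadratic expansion of `|w + a + i b|⁶` around `w`. -/
def sexticRemainder (w a b : ℝ) : ℝ :=
  ((w + a) ^ 2 + b ^ 2) ^ 3 - (w ^ 6 + 6 * w ^ 5 * a + 15 * w ^ 4 * a ^ 2 + 3 * w ^ 4 * b ^ 2)

lemma abs_sexticRemainder_le {w a b t : ℝ} (hw : 0 < w) (ht : 0 ≤ t) (h : t ^ 2 = a ^ 2 + b ^ 2) :
    |sexticRemainder w a b| ≤ 41 * (w ^ 3 * t ^ 3) + 22 * t ^ 6 := by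
  have hat : |a| ≤ t := abs_le_of_sq_le_sq (by nlinarith [sq_nonneg b]) ht
  have e : sexticRemainder w a b
      = 12 * w ^ 3 * t ^ 2 * a + 3 * w ^ 2 * t ^ 4 + (2 * w * a + t ^ 2) ^ 3 := by
    have ht4 : t ^ 4 = (a ^ 2 + b ^ 2) ^ 2 := by rw [← h]; ring
    rw [sexticRemainder, ht4, h]
    ring
  have h1 : |12 * w ^ 3 * t ^ 2 * a| ≤ 12 * w ^ 3 * t ^ 2 * t := by
    rw [abs_mul, abs_of_nonneg (by positivity : 0 ≤ 12 * w ^ 3 * t ^ 2)]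
    gcongr
  have h2 : |2 * w * a + t ^ 2| ≤ 2 * w * t + t ^ 2 := by
    refine (abs_add_le _ _).trans ?_
    rw [abs_mul, abs_of_nonneg (by positivity : 0 ≤ 2 * w), abs_of_nonneg (sq_nonneg t)]
    gcongr
  have h3 : |(2 * w * a + t ^ 2) ^ 3| ≤ (2 * w * t + t ^ 2) ^ 3 := by
    rw [abs_pow]
    gcongr
  have h4 : w ^ 2 * t ^ 4 ≤ w ^ 3 * t ^ 3 + t ^ 6 := by
    rcases le_total w t with hwt | hwt
    · have : w ^ 2 * t ^ 4 ≤ t ^ 2 * t ^ 4 := by gcongr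
      have : 0 ≤ w ^ 3 * t ^ 3 := by positivity
      nlinarith
    · have : w ^ 2 * t ^ 3 * t ≤ w ^ 2 * t ^ 3 * w := by gcongr
      have : 0 ≤ t ^ 6 := by positivity
      nlinarith
  have h5 : w * t ^ 5 ≤ w ^ 3 * t ^ 3 + t ^ 6 := by
    rcases le_total w t with hwt | hwt
    · have : w * t ^ 5 ≤ t * t ^ 5 := by gcongr
      have : 0 ≤ w ^ 3 * t ^ 3 := by positivity
      nlinarith
    · have : w * t ^ 3 * t ^ 2 ≤ w * t ^ 3 * w ^ 2 := by gcongr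
      have : 0 ≤ t ^ 6 := by positivity
      nlinarith
  rw [e]
  refine (abs_add_le _ _).trans ((add_le_add ((abs_add_le _ _).trans (add_le_add h1 le_rfl)) h3).trans ?_)
  rw [abs_of_nonneg (by positivity : 0 ≤ 3 * w ^ 2 * t ^ 4)]
  nlinarith

namespace IsEnergyProfile

variable {a b : ℝ → ℝ}

lemma abs_mul_sexticRemainder_le (ha : IsEnergyProfile a) (hb : IsEnergyProfile b) {N r : ℝ}
    (hN : 0 ≤ N) (hN1 : N ≤ 1) (hNab : N ^ 2 = dirichletForm a a + dirichletForm b b) (hr : 0 < r) :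
    |r ^ 2 * sexticRemainder (radialW r) (a r) (b r)| ≤ 63 * N * (a r ^ 2 + b r ^ 2) := by
  have hw := radialW_pos r
  set t := √(a r ^ 2 + b r ^ 2) with ht
  have ht0 : 0 ≤ t := Real.sqrt_nonneg _
  have ht2 : t ^ 2 = a r ^ 2 + b r ^ 2 := Real.sq_sqrt (by positivity)
  have h := abs_sexticRemainder_le hw ht0 ht2
  have hs : r * t ^ 2 ≤ N ^ 2 := by
    have := ha.mul_sq_le hr
    have := hb.mul_sq_le hr
    rw [ht2, hNab]
    linarith
  have h1 : r ^ 2 * radialW r ^ 3 * t ≤ N := by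
    refine le_of_sq_le_sq ?_ hN
    have h3 := pow_le_pow_left₀ (by positivity) (mul_radialW_sq_le_one (r := r)) 3
    calc (r ^ 2 * radialW r ^ 3 * t) ^ 2 = (r * radialW r ^ 2) ^ 3 * (r * t ^ 2) := by ring
      _ ≤ 1 ^ 3 * N ^ 2 := by gcongr
      _ = N ^ 2 := by ring
  have h2 : r ^ 2 * t ^ 4 ≤ N := by
    calc r ^ 2 * t ^ 4 = (r * t ^ 2) ^ 2 := by ring
      _ ≤ (N ^ 2) ^ 2 := by gcongr
      _ = N ^ 4 := by ring
      _ ≤ N := pow_le_of_le_one hN hN1 (by norm_num)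
  rw [abs_mul, abs_of_nonneg (sq_nonneg r), ← ht2]
  have k1 := mul_le_mul_of_nonneg_right h1 (sq_nonneg t)
  have k2 := mul_le_mul_of_nonneg_right h2 (sq_nonneg t)
  have k3 := mul_le_mul_of_nonneg_left h (sq_nonneg r)
  nlinarith

lemma integral_sextic (ha : IsEnergyProfile a) (hb : IsEnergyProfile b) {N : ℝ}
    (hN : 0 ≤ N) (hN1 : N ≤ 1) (hNab : N ^ 2 = dirichletForm a a + dirichletForm b b) :
    |(∫ r in Set.Ioi (0 : ℝ), r ^ 2 * ((radialW r + a r) ^ 2 + b r ^ 2) ^ 3)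
      - (weightedForm radialW radialW + 6 * weightedForm radialW a + 15 * weightedForm a a
        + 3 * weightedForm b b)| ≤ 378 * N ^ 3 := by
  have ca := ha.continuous
  have cb := hb.continuous
  have cw := continuous_radialW
  have HW := isEnergyProfile_radialW
  have hsq := ((ha.integrableOn_sq.add hb.integrableOn_sq).const_mul (63 * N))
  have hbd : ∀ᵐ r ∂(volume.restrict (Set.Ioi (0 : ℝ))),
      ‖r ^ 2 * sexticRemainder (radialW r) (a r) (b r)‖
        ≤ 63 * N * ((fun r => a r ^ 2) + fun r => b r ^ 2) r :=
    (ae_restrict_iff' measurableSet_Ioi).2 (Filter.Eventually.of_forall fun r hr =>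
      ha.abs_mul_sexticRemainder_le hb hN hN1 hNab hr)
  have hrem : IntegrableOn (fun r => r ^ 2 * sexticRemainder (radialW r) (a r) (b r))
      (Set.Ioi 0) := by
    refine Integrable.mono' hsq ?_ hbd
    unfold sexticRemainder
    exact (by fun_prop : Continuous _).aestronglyMeasurable
  have i1 := HW.integrableOn_weighted HW
  have i2 := (HW.integrableOn_weighted ha).const_mul 6
  have i3 := (ha.integrableOn_weighted ha).const_mul 15
  have i4 := (hb.integrableOn_weighted hb).const_mul 3
  have e : (∫ r in Set.Ioi (0 : ℝ), r ^ 2 * ((radialW r + a r) ^ 2 + b r ^ 2) ^ 3)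
      - (weightedForm radialW radialW + 6 * weightedForm radialW a + 15 * weightedForm a a
        + 3 * weightedForm b b)
      = ∫ r in Set.Ioi (0 : ℝ), r ^ 2 * sexticRemainder (radialW r) (a r) (b r) := by
    simp only [weightedForm]
    rw [← integral_const_mul, ← integral_const_mul, ← integral_const_mul, ← integral_add' i1 i2,
      ← integral_add' (i1.add i2) i3, ← integral_add' ((i1.add i2).add i3) i4, sub_eq_iff_eq_add,
      ← integral_add' hrem (((i1.add i2).add i3).add i4)]
    congr 1
    funext r
    simp only [sexticRemainder, Pi.add_apply]
    ring
  rw [e, ← Real.norm_eq_abs]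
  refine (norm_integral_le_of_norm_le hsq hbd).trans ?_
  rw [integral_const_mul]
  have e2 : ∫ r in Set.Ioi (0 : ℝ), ((fun r => a r ^ 2) + fun r => b r ^ 2) r
      = (∫ r in Set.Ioi (0 : ℝ), a r ^ 2) + ∫ r in Set.Ioi (0 : ℝ), b r ^ 2 :=
    integral_add ha.integrableOn_sq hb.integrableOn_sq
  have h1 := ha.integral_sq_le
  have h2 := hb.integral_sq_le
  rw [e2]
  have : (∫ r in Set.Ioi (0 : ℝ), a r ^ 2) + ∫ r in Set.Ioi (0 : ℝ), b r ^ 2 ≤ 6 * N ^ 2 := by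
    rw [hNab]; linarith
  have := mul_le_mul_of_nonneg_left this (by positivity : 0 ≤ 63 * N)
  linarith

lemma integral_kinetic (ha : IsEnergyProfile a) (hb : IsEnergyProfile b) :
    ∫ r in Set.Ioi (0 : ℝ), r ^ 2 * ((deriv radialW r + deriv a r) ^ 2 + deriv b r ^ 2)
      = dirichletForm radialW radialW + 2 * dirichletForm a radialW + dirichletForm a a
        + dirichletForm b b := by
  have HW := isEnergyProfile_radialW
  have i1 := HW.integrableOn_mul HW
  have i2 := (ha.integrableOn_mul HW).const_mul 2
  have i3 := ha.integrableOn_mul ha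
  have i4 := hb.integrableOn_mul hb
  simp only [dirichletForm]
  rw [← integral_const_mul, ← integral_add' i1 i2,
    ← integral_add' (i1.add i2) i3, ← integral_add' ((i1.add i2).add i3) i4]
  congr 1
  funext r
  simp only [Pi.add_apply]
  ring

end IsEnergyProfile

lemma modulation_algebra {k β D m N α δ : ℝ} (hk : 0 < k) (hN : 0 ≤ N) (hβ : β = |α| * k)
    (hD : 0 ≤ D) (hm : 0 ≤ m) (hND : N ^ 2 = β ^ 2 + D)
    (hE : 2 / 7 * D + m / 4 ≤ 2 * β ^ 2 + 63 * N ^ 3) (hN1 : N ≤ 1 / 441) (hNk : N ≤ k / 4)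
    (hδ : δ = |2 * α * k ^ 2 + N ^ 2|) :
    m ≤ (2 * k + 1 + 4 / k + 144 / k ^ 2) * δ ^ 2 ∧
      δ ≤ (2 * k + 1 + 4 / k + 144 / k ^ 2) * N ∧ N ≤ (2 * k + 1 + 4 / k + 144 / k ^ 2) * δ := by
  have hβ0 : 0 ≤ β := by rw [hβ]; positivity
  have hN3 : N ^ 3 ≤ N ^ 2 * (1 / 441) := by
    have := mul_le_mul_of_nonneg_left hN1 (sq_nonneg N)
    linarith
  have h1 : N ≤ 4 * β := by
    refine le_of_sq_le_sq ?_ (by positivity)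
    nlinarith
  have h2 : β ≤ N := by
    refine le_of_sq_le_sq ?_ hN
    linarith
  have hN2 : N ^ 2 ≤ N * (k / 4) := by
    have := mul_le_mul_of_nonneg_left hNk hN
    linarith
  have hab : |2 * α * k ^ 2| = 2 * β * k := by
    rw [abs_mul, abs_mul, abs_of_nonneg (sq_nonneg k), hβ, abs_of_pos (by norm_num : (0:ℝ) < 2)]
    ring
  have hδ0 : 0 ≤ δ := hδ ▸ abs_nonneg _
  have h3 : δ ≤ (2 * k + 1) * N := by
    have := abs_add_le (2 * α * k ^ 2) (N ^ 2)
    rw [hab, abs_of_nonneg (sq_nonneg N), ← hδ] at this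
    nlinarith
  have h4 : k * N ≤ 4 * δ := by
    have := abs_sub_abs_le_abs_sub (2 * α * k ^ 2) (-N ^ 2)
    rw [hab, abs_neg, abs_of_nonneg (sq_nonneg N), sub_neg_eq_add, ← hδ] at this
    nlinarith
  have h5 : N ≤ 4 / k * δ := by
    rw [div_mul_eq_mul_div, le_div_iff₀ hk]
    linarith
  have h6 : m ≤ 9 * N ^ 2 := by nlinarith
  have p1 : 0 < 4 / k := by positivity
  have p2 : 0 < 144 / k ^ 2 := by positivity
  refine ⟨?_, ?_, ?_⟩
  · have : N ^ 2 ≤ (4 / k * δ) ^ 2 := by gcongr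
    have e : (4 / k * δ) ^ 2 * 9 = 144 / k ^ 2 * δ ^ 2 := by
      field_simp
      ring
    have : 0 ≤ (2 * k + 1 + 4 / k) * δ ^ 2 := by positivity
    nlinarith
  · have : 0 ≤ (4 / k + 144 / k ^ 2) * N := by positivity
    linarith
  · have : 0 ≤ (2 * k + 1 + 144 / k ^ 2) * δ := by positivity
    linarith

/-- Modulation estimates for radial profiles. -/
theorem modulation_estimates_profile :
    ∃ δ₀ > (0 : ℝ), ∃ C > (0 : ℝ), ∀ (a b : ℝ → ℝ) (m δ N : ℝ), IsEnergyProfile a →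
      IsEnergyProfile b → 0 ≤ m → 0 ≤ N → N ^ 2 = dirichletForm a a + dirichletForm b b →
      dirichletForm b radialW = 0 → dirichletForm a radialW1 = 0 → N ≤ δ₀ →
      δ = |dirichletForm radialW radialW -
        ∫ r in Set.Ioi (0 : ℝ), r ^ 2 * ((deriv radialW r + deriv a r) ^ 2 + deriv b r ^ 2)| →
      1 / 2 * (∫ r in Set.Ioi (0 : ℝ), r ^ 2 * ((deriv radialW r + deriv a r) ^ 2 + deriv b r ^ 2))
        - 1 / 6 * (∫ r in Set.Ioi (0 : ℝ), r ^ 2 * ((radialW r + a r) ^ 2 + b r ^ 2) ^ 3) + 1 / 4 * m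
        = 1 / 2 * dirichletForm radialW radialW - 1 / 6 * weightedForm radialW radialW →
      m ≤ C * δ ^ 2 ∧ δ ≤ C * N ∧ N ≤ C * δ := by
  have HW := isEnergyProfile_radialW
  have HW1 := isEnergyProfile_radialW1
  have hK := dirichletForm_radialW_pos
  set k := √(dirichletForm radialW radialW) with hk
  have hk0 : 0 < k := Real.sqrt_pos.2 hK
  have hk2 : k ^ 2 = dirichletForm radialW radialW := Real.sq_sqrt hK.le
  refine ⟨min (1 / 441) (k / 4), by positivity, 2 * k + 1 + 4 / k + 144 / k ^ 2, by positivity, ?_⟩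
  intro a b m δ N ha hb hm hN hNab hbw haw hNδ hδ hE
  rw [ha.integral_kinetic hb] at hδ hE
  have hN1 : N ≤ 1 / 441 := hNδ.trans (min_le_left _ _)
  have hNk : N ≤ k / 4 := hNδ.trans (min_le_right _ _)
  have hP := ha.integral_sextic hb hN (hN1.trans (by norm_num)) hNab
  set P := ∫ r in Set.Ioi (0 : ℝ), r ^ 2 * ((radialW r + a r) ^ 2 + b r ^ 2) ^ 3
  set α := dirichletForm a radialW / k ^ 2 with hα
  have hα' : dirichletForm a radialW = α * k ^ 2 := by rw [hα]; field_simp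
  have MWW := dirichletForm_radialW HW
  have MWa := dirichletForm_radialW ha
  rw [dirichletForm_comm] at MWa
  have hh := ha.sub_smul HW α
  have hgap := hh.weightedForm_le_of_orthogonal ?_ ?_
  · have hDh := dirichletForm_self_nonneg (fun r => a r - α * radialW r)
    have hDb := dirichletForm_self_nonneg b
    have hgapb := hb.weightedForm_le_of_orthogonal_radialW hbw
    rw [ha.dirichletForm_sub_smul_self HW, ← hk2, hα'] at hgap hDh
    rw [ha.weightedForm_sub_smul_self HW, weightedForm_comm a radialW] at hgap
    rw [← hk2] at MWW hδ hE
    rw [hα'] at MWa hδ hE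
    have e1 : weightedForm radialW radialW = k ^ 2 := by linarith
    have e2 : weightedForm radialW a = α * k ^ 2 := by linarith
    rw [e1, e2] at hgap hP
    rw [e1] at hE
    rw [abs_le] at hP
    refine modulation_algebra (β := |α| * k) (α := α)
      (D := dirichletForm a a - α ^ 2 * k ^ 2 + dirichletForm b b) hk0 hN rfl
      (by nlinarith) hm ?_ ?_ hN1 hNk ?_
    · rw [hNab, mul_pow, sq_abs]
      ring
    · rw [mul_pow, sq_abs]
      nlinarith [hP.1, hP.2]
    · rw [hδ, hNab, ← abs_neg]
      congr 1
      ring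
  · rw [ha.dirichletForm_sub_smul_left HW HW, hα', hk2]
    ring
  · rw [ha.dirichletForm_sub_smul_left HW HW1, haw, dirichletForm_comm radialW,
      dirichletForm_radialW1_radialW]
    ring


/-! ### Radial functions on `ℝ³` -/

/-- The area of the unit sphere of `ℝ³`. -/
def sphereArea : ℝ := 3 * volume.real (Metric.ball (0 : E3) 1)

lemma sphereArea_pos : 0 < sphereArea := by
  have : 0 < volume.real (Metric.ball (0 : E3) 1) :=
    ENNReal.toReal_pos (Metric.measure_ball_pos _ _ one_pos).ne' measure_ball_lt_top.ne
  unfold sphereArea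
  positivity

lemma integral_comp_norm_E3 (φ : ℝ → ℝ) :
    ∫ x : E3, φ ‖x‖ = sphereArea * ∫ r in Set.Ioi (0 : ℝ), r ^ 2 * φ r := by
  rw [integral_fun_norm_addHaar]
  simp [sphereArea, finrank_euclideanSpace, mul_assoc]

lemma integrable_comp_norm_E3 {φ : ℝ → ℝ} :
    Integrable (fun x : E3 => φ ‖x‖) ↔ IntegrableOn (fun r => r ^ 2 * φ r) (Set.Ioi 0) := by
  rw [integrable_fun_norm_addHaar]
  simp [finrank_euclideanSpace]

lemma fderiv_comp_norm {V : Type*} [NormedAddCommGroup V] [NormedSpace ℝ V] {φ : ℝ → V}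
    {x : E3} (hx : x ≠ 0) (hφ : DifferentiableAt ℝ φ ‖x‖) (v : E3) :
    fderiv ℝ (fun y : E3 => φ ‖y‖) x v = (inner ℝ x v / ‖x‖) • deriv φ ‖x‖ := by
  have hx' : ‖x‖ ≠ 0 := norm_ne_zero_iff.2 hx
  have h1 := ((hasStrictFDerivAt_norm_sq x).hasFDerivAt).sqrt (pow_ne_zero 2 hx')
  simp only [Real.sqrt_sq (norm_nonneg _)] at h1
  have h2 : HasFDerivAt (fun y : E3 => φ ‖y‖) _ x := hφ.hasFDerivAt.comp x h1
  rw [h2.fderiv]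
  rw [ContinuousLinearMap.comp_apply, fderiv_eq_smul_deriv]
  congr 1
  simp only [smul_apply, innerSL_apply_apply, smul_eq_mul, nsmul_eq_mul]
  field_simp
  norm_num

lemma inner_e3 (x : E3) (i : Fin 3) : inner ℝ x (e3 i) = x i := by
  simp [e3, EuclideanSpace.inner_single_right]

lemma sum_sq_div_norm {x : E3} (hx : x ≠ 0) : ∑ i, (x i / ‖x‖) ^ 2 = 1 := by
  have hx' : ‖x‖ ≠ 0 := norm_ne_zero_iff.2 hx
  simp only [div_pow]
  rw [← Finset.sum_div, ← EuclideanSpace.real_norm_sq_eq, div_self (pow_ne_zero 2 hx')]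

lemma gradSqC_comp_norm {φ : ℝ → ℂ} (hφ : Differentiable ℝ φ) {x : E3} (hx : x ≠ 0) :
    gradSqC (fun y => φ ‖y‖) x = ‖deriv φ ‖x‖‖ ^ 2 := by
  simp only [gradSqC, pdC, fderiv_comp_norm hx (hφ _), inner_e3, norm_smul, mul_pow,
    Real.norm_eq_abs, sq_abs]
  rw [← Finset.sum_mul, sum_sq_div_norm hx, one_mul]

lemma sum_pdR_comp_norm {φ ψ : ℝ → ℝ} (hφ : Differentiable ℝ φ) (hψ : Differentiable ℝ ψ)
    {x : E3} (hx : x ≠ 0) :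
    ∑ j, pdR j (fun y => φ ‖y‖) x * pdR j (fun y => ψ ‖y‖) x = deriv φ ‖x‖ * deriv ψ ‖x‖ := by
  simp only [pdR, fderiv_comp_norm hx (hφ _), fderiv_comp_norm hx (hψ _), inner_e3, smul_eq_mul]
  have := sum_sq_div_norm hx
  calc ∑ j, x j / ‖x‖ * deriv φ ‖x‖ * (x j / ‖x‖ * deriv ψ ‖x‖)
      = (∑ j, (x j / ‖x‖) ^ 2) * (deriv φ ‖x‖ * deriv ψ ‖x‖) := by
        rw [Finset.sum_mul]
        exact Finset.sum_congr rfl fun j _ => by ring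
    _ = _ := by rw [this, one_mul]

lemma ae_ne_zero_E3 : ∀ᵐ x : E3, x ≠ 0 := by
  simp [ae_iff]

lemma integral_eq_of_radial {u : E3 → ℝ} {φ : ℝ → ℝ} (h : ∀ x, x ≠ 0 → u x = φ ‖x‖) :
    ∫ x, u x = sphereArea * ∫ r in Set.Ioi (0 : ℝ), r ^ 2 * φ r := by
  rw [← integral_comp_norm_E3]
  exact integral_congr_ae (ae_ne_zero_E3.mono h)

lemma integrableOn_of_radial {u : E3 → ℝ} {φ : ℝ → ℝ} (hu : Integrable u)
    (h : ∀ x, x ≠ 0 → u x = φ ‖x‖) : IntegrableOn (fun r => r ^ 2 * φ r) (Set.Ioi 0) := by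
  rw [← integrable_comp_norm_E3]
  exact hu.congr (ae_ne_zero_E3.mono h)

lemma W_eq (x : E3) : W x = radialW ‖x‖ := rfl

lemma W1_eq (x : E3) : W1 x = radialW1 ‖x‖ := by
  have e : W = fun y => radialW ‖y‖ := rfl
  rcases eq_or_ne x 0 with rfl | hx
  · have := radialW_sq 0
    have h3 : radialW 0 ^ 3 = radialW 0 := by linear_combination radialW 0 / 3 * this
    simp only [W1, W_eq, radialW1, map_zero, norm_zero, h3]
    norm_num
  · have hx' : ‖x‖ ≠ 0 := norm_ne_zero_iff.2 hx
    have hw := radialW_sq ‖x‖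
    simp only [W1]
    rw [e, fderiv_comp_norm hx (hasDerivAt_radialW _).differentiableAt, deriv_radialW,
      real_inner_self_eq_norm_sq, radialW1, smul_eq_mul, pow_two ‖x‖, mul_self_div_self]
    linear_combination (-radialW ‖x‖ / 6) * hw

/-! ### Scaling -/

lemma integral_Ioi_scale (g : ℝ → ℝ) {c : ℝ} (hc : 0 < c) :
    ∫ r in Set.Ioi (0 : ℝ), c * g (c * r) = ∫ r in Set.Ioi (0 : ℝ), g r := by
  rw [integral_const_mul, integral_comp_mul_left_Ioi g 0 hc, mul_zero, smul_eq_mul,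
    mul_inv_cancel_left₀ hc.ne']

lemma integrableOn_Ioi_scale {g : ℝ → ℝ} {c : ℝ} (hc : 0 < c) (hg : IntegrableOn g (Set.Ioi 0)) :
    IntegrableOn (fun r => c * g (c * r)) (Set.Ioi 0) := by
  refine Integrable.const_mul ?_ c
  have := (integrableOn_Ioi_comp_mul_left_iff g 0 hc).2 (by rwa [mul_zero])
  exact this

lemma hasDerivAt_rescale {p : ℝ → ℝ} (hp : Differentiable ℝ p) (μ r : ℝ) :
    HasDerivAt (fun s => √μ * p (μ * s)) (√μ * (μ * deriv p (μ * r))) r := by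
  have h := (hp (μ * r)).hasDerivAt.comp r ((hasDerivAt_id r).const_mul μ)
  refine (h.const_mul √μ).congr_deriv ?_
  ring

/-- Scaling invariance of the Dirichlet form. -/
lemma integral_deriv_rescale {p q : ℝ → ℝ} (hp : Differentiable ℝ p) (hq : Differentiable ℝ q)
    {μ : ℝ} (hμ : 0 < μ) :
    ∫ r in Set.Ioi (0 : ℝ), r ^ 2 * (deriv (fun s => √μ * p (μ * s)) r
      * deriv (fun s => √μ * q (μ * s)) r) = dirichletForm p q := by
  rw [dirichletForm, ← integral_Ioi_scale (fun r => r ^ 2 * (deriv p r * deriv q r)) hμ]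
  congr 1
  funext r
  rw [(hasDerivAt_rescale hp μ r).deriv, (hasDerivAt_rescale hq μ r).deriv]
  have := Real.sq_sqrt hμ.le
  linear_combination (r ^ 2 * μ ^ 2 * deriv p (μ * r) * deriv q (μ * r)) * this

lemma norm_sq_deriv_complex {φ : ℝ → ℂ} (hφ : Differentiable ℝ φ) (r : ℝ) :
    ‖deriv φ r‖ ^ 2 = deriv (fun s => (φ s).re) r ^ 2 + deriv (fun s => (φ s).im) r ^ 2 := by
  have h := (hφ r).hasDerivAt
  have h1 : HasDerivAt (fun s => (φ s).re) (deriv φ r).re r :=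
    Complex.reCLM.hasFDerivAt.comp_hasDerivAt r h
  have h2 : HasDerivAt (fun s => (φ s).im) (deriv φ r).im r :=
    Complex.imCLM.hasFDerivAt.comp_hasDerivAt r h
  rw [h1.deriv, h2.deriv, Complex.sq_norm, Complex.normSq_apply]
  ring

lemma IsEnergyProfile.of_integrableOn {φ : ℝ → ℝ} (hφ : ContDiff ℝ 1 φ)
    (h0 : IntegrableOn (fun r => r ^ 2 * φ r ^ 2) (Set.Ioi 0))
    (h1 : IntegrableOn (fun r => r ^ 2 * deriv φ r ^ 2) (Set.Ioi 0)) : IsEnergyProfile φ := by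
  refine ⟨hφ, h1, ?_⟩
  have c := hφ.continuous
  have c' := (contDiff_one_iff_deriv.1 hφ).2
  have d := (contDiff_one_iff_deriv.1 hφ).1
  have hsub : Set.Ioi (1 : ℝ) ⊆ Set.Ioi 0 := Set.Ioi_subset_Ioi zero_le_one
  have h0' := h0.mono_set hsub
  have h1' := h1.mono_set hsub
  have i0 : IntegrableOn (fun r => φ r ^ 2) (Set.Ioi 1) := by
    refine Integrable.mono' h0' (by fun_prop : Continuous _).aestronglyMeasurable
      ((ae_restrict_iff' measurableSet_Ioi).2 (Filter.Eventually.of_forall fun r hr => ?_))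
    have hr : (1 : ℝ) < r := hr
    rw [Real.norm_eq_abs, abs_of_nonneg (sq_nonneg _)]
    exact le_mul_of_one_le_left (sq_nonneg _) (one_le_pow₀ hr.le)
  have i1 : IntegrableOn (fun r => 2 * φ r * deriv φ r) (Set.Ioi 1) := by
    refine Integrable.mono' (h0'.add h1') (by fun_prop : Continuous _).aestronglyMeasurable
      ((ae_restrict_iff' measurableSet_Ioi).2 (Filter.Eventually.of_forall fun r hr => ?_))
    have hr : (1 : ℝ) < r := hr
    have hr2 : 1 ≤ r ^ 2 := one_le_pow₀ hr.le
    have e : |2 * φ r * deriv φ r| ≤ φ r ^ 2 + deriv φ r ^ 2 := by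
      rw [abs_le]
      constructor <;> nlinarith [sq_nonneg (φ r - deriv φ r), sq_nonneg (φ r + deriv φ r)]
    simp only [Pi.add_apply, Real.norm_eq_abs]
    nlinarith [sq_nonneg (φ r), sq_nonneg (deriv φ r)]
  have h := tendsto_zero_of_hasDerivAt_of_integrableOn_Ioi (f := fun r => φ r ^ 2) (fun r _ =>
    ((d r).hasDerivAt.pow 2).congr_deriv (by simp)) i1 i0
  have h2 := h.sqrt
  simp only [Real.sqrt_sq_eq_abs, Real.sqrt_zero] at h2
  exact (tendsto_zero_iff_abs_tendsto_zero _).2 h2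


/-! ### Reduction to profiles -/

/-- The profile `s ↦ e^{-iθ} μ^{-1/2} F(s / μ)` of a radial function, normalised to be compared
with `W`. -/
def normalizedProfile (F : ℝ → ℂ) (θ μ s : ℝ) : ℂ :=
  Complex.exp (-θ * Complex.I) * ((√μ)⁻¹ : ℝ) * F (μ⁻¹ * s)

section NormalizedProfile

variable {F : ℝ → ℂ} {θ μ : ℝ}

lemma norm_exp_neg_mul_I (θ : ℝ) : ‖Complex.exp (-θ * Complex.I)‖ = 1 := by
  rw [← Complex.ofReal_neg, Complex.norm_exp_ofReal_mul_I]

lemma norm_sq_phase (θ : ℝ) (hμ : 0 < μ) :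
    ‖Complex.exp (-θ * Complex.I) * ((√μ)⁻¹ : ℝ)‖ ^ 2 = μ⁻¹ := by
  rw [norm_mul, norm_exp_neg_mul_I, one_mul, Complex.norm_real, Real.norm_eq_abs, sq_abs, inv_pow,
    Real.sq_sqrt hμ.le]

lemma norm_sq_normalizedProfile (hμ : 0 < μ) (s : ℝ) :
    ‖normalizedProfile F θ μ s‖ ^ 2 = μ⁻¹ * ‖F (μ⁻¹ * s)‖ ^ 2 := by
  rw [normalizedProfile, norm_mul, mul_pow, norm_sq_phase θ hμ]

lemma contDiff_normalizedProfile (hF : ContDiff ℝ 1 F) :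
    ContDiff ℝ 1 (normalizedProfile F θ μ) := by
  unfold normalizedProfile
  exact contDiff_const.mul (hF.comp (contDiff_const.mul contDiff_id))

lemma norm_sq_deriv_normalizedProfile (hF : ContDiff ℝ 1 F) (hμ : 0 < μ) (s : ℝ) :
    ‖deriv (normalizedProfile F θ μ) s‖ ^ 2 = μ⁻¹ * (μ⁻¹ ^ 2 * ‖deriv F (μ⁻¹ * s)‖ ^ 2) := by
  have hd := hF.differentiable one_ne_zero
  have h := (hd (μ⁻¹ * s)).hasDerivAt.scomp s ((hasDerivAt_id s).const_mul μ⁻¹)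
  have h2 : HasDerivAt (normalizedProfile F θ μ) _ s :=
    h.const_mul (Complex.exp (-θ * Complex.I) * ((√μ)⁻¹ : ℝ))
  rw [h2.deriv, norm_mul, mul_pow, norm_sq_phase θ hμ, norm_smul, mul_pow, Real.norm_eq_abs, sq_abs,
    mul_one]

lemma modG_eq (hμ : 0 < μ) {f : E3 → ℂ} (hf : ∀ x, f x = F ‖x‖) (x : E3) :
    modG f θ μ x = (√μ : ℂ) * (normalizedProfile F θ μ (μ * ‖x‖) - radialW (μ * ‖x‖)) := by
  have hs : (√μ : ℂ) ≠ 0 := by exact_mod_cast (Real.sqrt_pos.2 hμ).ne'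
  rw [modG, normalizedProfile, W_eq, norm_smul, Real.norm_eq_abs, abs_of_pos hμ, hf,
    inv_mul_cancel_left₀ hμ.ne']
  push_cast
  field_simp

end NormalizedProfile

lemma IsEnergyProfile.of_complex {v : ℝ → ℂ} (hv : ContDiff ℝ 1 v)
    (h0 : IntegrableOn (fun r => r ^ 2 * ‖v r‖ ^ 2) (Set.Ioi 0))
    (h1 : IntegrableOn (fun r => r ^ 2 * ‖deriv v r‖ ^ 2) (Set.Ioi 0)) :
    IsEnergyProfile (fun r => (v r).re) ∧ IsEnergyProfile (fun r => (v r).im) := by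
  have hd := hv.differentiable one_ne_zero
  have hre : ContDiff ℝ 1 fun r => (v r).re := Complex.reCLM.contDiff.comp hv
  have him : ContDiff ℝ 1 fun r => (v r).im := Complex.imCLM.contDiff.comp hv
  have c1 := hre.continuous
  have c2 := him.continuous
  have c1' := (contDiff_one_iff_deriv.1 hre).2
  have c2' := (contDiff_one_iff_deriv.1 him).2
  have e0 : ∀ r, ‖v r‖ ^ 2 = (v r).re ^ 2 + (v r).im ^ 2 := fun r => by
    rw [Complex.sq_norm, Complex.normSq_apply]
    ring
  have e1 := norm_sq_deriv_complex hd
  have dom : ∀ {p q u : ℝ → ℝ}, Continuous p → (∀ r, u r = p r ^ 2 + q r ^ 2) →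
      IntegrableOn (fun r => r ^ 2 * u r) (Set.Ioi 0) →
      IntegrableOn (fun r => r ^ 2 * p r ^ 2) (Set.Ioi 0) := by
    intro p q u hp hu hi
    refine Integrable.mono' hi (by fun_prop : Continuous _).aestronglyMeasurable
      (Filter.Eventually.of_forall fun r => ?_)
    rw [Real.norm_eq_abs, abs_of_nonneg (by positivity), hu]
    gcongr
    linarith [sq_nonneg (q r)]
  exact ⟨IsEnergyProfile.of_integrableOn hre (dom c1 e0 h0) (dom c1' e1 h1),
    IsEnergyProfile.of_integrableOn him
      (dom (q := fun r => (v r).re) c2 (fun r => by rw [e0, add_comm]) h0)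
      (dom (q := deriv fun r => (v r).re) c2' (fun r => by rw [e1, add_comm]) h1)⟩

lemma integral_gradSqR_W : ∫ x, gradSqR W x = sphereArea * dirichletForm radialW radialW := by
  have hd := isEnergyProfile_radialW.differentiable
  refine integral_eq_of_radial (φ := fun r => deriv radialW r * deriv radialW r) fun x hx => ?_
  rw [← sum_pdR_comp_norm hd hd hx]
  simp only [gradSqR, pow_two]
  rfl

lemma Ecrit_Wc : Ecrit Wc = sphereArea *
    (1 / 2 * dirichletForm radialW radialW - 1 / 6 * weightedForm radialW radialW) := by
  have HW := isEnergyProfile_radialW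
  have hd : ∀ r, HasDerivAt (fun r => (radialW r : ℂ)) (deriv radialW r : ℝ) r := fun r =>
    (HW.differentiable r).hasDerivAt.ofReal_comp
  rw [Ecrit, integral_eq_of_radial (φ := fun r =>
    1 / 2 * (deriv radialW r * deriv radialW r) - 1 / 6 * radialW r ^ 6)]
  · congr 1
    rw [dirichletForm, weightedForm, ← integral_const_mul, ← integral_const_mul, ← integral_sub
      ((HW.integrableOn_mul HW).const_mul _) ((HW.integrableOn_weighted HW).const_mul _)]
    congr 1
    funext r
    ring
  · intro x hx
    have e : gradSqC Wc x = ‖deriv (fun r => (radialW r : ℂ)) ‖x‖‖ ^ 2 :=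
      gradSqC_comp_norm (φ := fun r => (radialW r : ℂ)) (fun r => (hd r).differentiableAt) hx
    rw [e, (hd _).deriv, Complex.norm_real, Real.norm_eq_abs, sq_abs, Wc, Complex.norm_real,
      Real.norm_eq_abs, W_eq, abs_of_pos (radialW_pos _), pow_two]


/-- Modulation estimates at threshold energy. -/
theorem modulation_estimates :
    ∃ δ₀ > (0:ℝ), ∃ C > (0:ℝ), ∀ (f : E3 → ℂ) (θ μ : ℝ), 0 < μ →
      IsRadial f → ContDiff ℝ 1 f →
      Integrable (fun x : E3 => ‖f x‖ ^ 2) →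
      Integrable (fun x : E3 => ‖f x‖ ^ 4) →
      Integrable (fun x : E3 => ‖f x‖ ^ 6) →
      Integrable (gradSqC f) →
      Ecq f = Ecrit Wc →
      Real.sqrt (∫ x : E3, gradSqC (modG f θ μ) x) ≤ δ₀ →
      (∫ x : E3, ∑ j, pdR j (fun y => (modG f θ μ y).im) x
          * pdR j (fun y => Real.sqrt μ * W (μ • y)) x) = 0 →
      (∫ x : E3, ∑ j, pdR j (fun y => (modG f θ μ y).re) x
          * pdR j (fun y => Real.sqrt μ * W1 (μ • y)) x) = 0 →
      (∫ x : E3, ‖f x‖ ^ 4) ≤ C * deltaF f ^ 2 ∧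
      C⁻¹ * deltaF f ≤ Real.sqrt (∫ x : E3, gradSqC (modG f θ μ) x) ∧
      Real.sqrt (∫ x : E3, gradSqC (modG f θ μ) x) ≤ C * deltaF f := by
  obtain ⟨δ₀, hδ₀, C, hC, key⟩ := modulation_estimates_profile
  have hA := sphereArea_pos
  set A := sphereArea
  have hsA : 0 < √A := Real.sqrt_pos.2 hA
  have hsA2 : √A ^ 2 = A := Real.sq_sqrt hA.le
  refine ⟨√A * δ₀, by positivity, C * (1 / A + √A + 1 / √A), by positivity, ?_⟩
  intro f θ μ hμ hrad hf h2 h4 h6 hgrad hE hsmall him hre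
  have he : ‖e3 0‖ = 1 := by simp [e3]
  set F : ℝ → ℂ := fun r => f (r • e3 0)
  have hfF : ∀ x, f x = F ‖x‖ := fun x => hrad _ _ (by rw [norm_smul, he]; simp)
  have hF : ContDiff ℝ 1 F := hf.comp (contDiff_id.smul contDiff_const)
  have hFd : Differentiable ℝ F := hF.differentiable one_ne_zero
  have hf' : f = fun x => F ‖x‖ := funext hfF
  have gradf : ∀ x, x ≠ 0 → gradSqC f x = ‖deriv F ‖x‖‖ ^ 2 := fun x hx => by
    rw [hf']
    exact gradSqC_comp_norm hFd hx
  have I2 := integrableOn_of_radial h2 (φ := fun r => ‖F r‖ ^ 2) fun x _ => by rw [hfF]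
  have Ig := integrableOn_of_radial hgrad (φ := fun r => ‖deriv F r‖ ^ 2) gradf
  set v := normalizedProfile F θ μ with hv
  have hvc : ContDiff ℝ 1 v := contDiff_normalizedProfile hF
  have hvd : Differentiable ℝ v := hvc.differentiable one_ne_zero
  have hμi : 0 < μ⁻¹ := inv_pos.2 hμ
  have scale2 : ∀ s, s ^ 2 * ‖deriv v s‖ ^ 2
      = μ⁻¹ * ((μ⁻¹ * s) ^ 2 * ‖deriv F (μ⁻¹ * s)‖ ^ 2) := fun s => by
    rw [hv, norm_sq_deriv_normalizedProfile hF hμ]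
    ring
  have scale6 : ∀ s, s ^ 2 * (‖v s‖ ^ 2) ^ 3
      = μ⁻¹ * ((μ⁻¹ * s) ^ 2 * ‖F (μ⁻¹ * s)‖ ^ 6) := fun s => by
    rw [hv, norm_sq_normalizedProfile hμ]
    ring
  obtain ⟨Hre, Him⟩ := IsEnergyProfile.of_complex hvc
    (by
      refine ((integrableOn_Ioi_scale hμi I2).const_mul (μ ^ 2)).congr
        (Filter.Eventually.of_forall fun s => ?_)
      simp only [hv, norm_sq_normalizedProfile hμ]
      field_simp)
    (by
      simp only [scale2]
      exact integrableOn_Ioi_scale hμi Ig)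
  have HW := isEnergyProfile_radialW
  have HW1 := isEnergyProfile_radialW1
  set a : ℝ → ℝ := fun r => (v r).re - 1 * radialW r with ha
  set b : ℝ → ℝ := fun r => (v r).im with hb
  have Ha : IsEnergyProfile a := Hre.sub_smul HW 1
  have hda : ∀ r, deriv (fun s => (v s).re) r = deriv radialW r + deriv a r := fun r => by
    rw [ha, Hre.deriv_sub_smul HW]
    ring
  have normv : ∀ r, ‖v r‖ ^ 2 = (radialW r + a r) ^ 2 + b r ^ 2 := fun r => by
    rw [Complex.sq_norm, Complex.normSq_apply]
    simp only [ha, hb]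
    ring
  have normdv : ∀ r, ‖deriv v r‖ ^ 2 = (deriv radialW r + deriv a r) ^ 2 + deriv b r ^ 2 :=
    fun r => by rw [norm_sq_deriv_complex hvd, hda]
  have gre : ∀ y, (modG f θ μ y).re = √μ * a (μ * ‖y‖) := fun y => by
    rw [modG_eq hμ hfF, Complex.re_ofReal_mul, Complex.sub_re, Complex.ofReal_re]
    simp only [ha, one_mul, hv]
  have gim : ∀ y, (modG f θ μ y).im = √μ * b (μ * ‖y‖) := fun y => by
    rw [modG_eq hμ hfF, Complex.im_ofReal_mul, Complex.sub_im, Complex.ofReal_im, sub_zero]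
  have normμ : ∀ y : E3, ‖μ • y‖ = μ * ‖y‖ := fun y => by
    rw [norm_smul, Real.norm_eq_abs, abs_of_pos hμ]
  have drescale : ∀ {p : ℝ → ℝ}, Differentiable ℝ p → Differentiable ℝ fun s => √μ * p (μ * s) :=
    fun hp s => (hasDerivAt_rescale hp μ s).differentiableAt
  have Da := Ha.differentiable
  have Db := Him.differentiable
  have orth : ∀ {p q : ℝ → ℝ}, Differentiable ℝ p → Differentiable ℝ q →
      ∫ x : E3, ∑ j, pdR j (fun y => √μ * p (μ * ‖y‖)) x * pdR j (fun y => √μ * q (μ * ‖y‖)) x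
        = A * dirichletForm p q := by
    intro p q hp hq
    rw [← integral_deriv_rescale hp hq hμ]
    exact integral_eq_of_radial (φ := fun r => deriv (fun s => √μ * p (μ * s)) r
      * deriv (fun s => √μ * q (μ * s)) r) fun x hx =>
        sum_pdR_comp_norm (drescale hp) (drescale hq) hx
  simp only [gim, W_eq, normμ] at him
  simp only [gre, W1_eq, normμ] at hre
  rw [orth Db HW.differentiable] at him
  rw [orth Da HW1.differentiable] at hre
  have ob : dirichletForm b radialW = 0 := (mul_eq_zero.1 him).resolve_left hA.ne'
  have oa : dirichletForm a radialW1 = 0 := (mul_eq_zero.1 hre).resolve_left hA.ne'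
  have hG : ∫ x, gradSqC (modG f θ μ) x = A * (dirichletForm a a + dirichletForm b b) := by
    set G : ℝ → ℂ := fun r => (√μ : ℂ) * (v (μ * r) - radialW (μ * r)) with hGdef
    have hGe : modG f θ μ = fun x => G ‖x‖ := funext fun x => modG_eq hμ hfF x
    have hGd : Differentiable ℝ G := by
      have h1 : Differentiable ℝ fun r : ℝ => (radialW (μ * r) : ℂ) := fun r =>
        (((HW.differentiable (μ * r)).hasDerivAt.comp r
          ((hasDerivAt_id r).const_mul μ)).ofReal_comp).differentiableAt
      have h2 : Differentiable ℝ fun r : ℝ => v (μ * r) :=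
        hvd.comp (differentiable_id.const_mul μ)
      exact (h2.sub h1).const_mul _
    have G1 : (fun s => (G s).re) = fun s => √μ * a (μ * s) := funext fun s => by
      simp only [hGdef]
      rw [Complex.re_ofReal_mul, Complex.sub_re, Complex.ofReal_re]
      simp only [ha, one_mul]
    have G2 : (fun s => (G s).im) = fun s => √μ * b (μ * s) := funext fun s => by
      simp only [hGdef]
      rw [Complex.im_ofReal_mul, Complex.sub_im, Complex.ofReal_im, sub_zero]
    rw [hGe, integral_eq_of_radial (φ := fun r => ‖deriv G r‖ ^ 2)
      fun x hx => gradSqC_comp_norm hGd hx]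
    congr 1
    rw [dirichletForm, dirichletForm, ← integral_add (Ha.integrableOn_mul Ha)
      (Him.integrableOn_mul Him), ← integral_Ioi_scale (fun r => r ^ 2 * (deriv a r * deriv a r)
        + r ^ 2 * (deriv b r * deriv b r)) hμ]
    congr 1
    funext r
    rw [norm_sq_deriv_complex hGd, G1, G2, (hasDerivAt_rescale Da μ r).deriv,
      (hasDerivAt_rescale Db μ r).deriv]
    linear_combination (r ^ 2 * μ ^ 2 * (deriv a (μ * r) ^ 2 + deriv b (μ * r) ^ 2))
      * Real.sq_sqrt hμ.le
  have hDa : ∀ {p : ℝ → ℝ}, 0 ≤ dirichletForm p p := by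
    intro p
    exact setIntegral_nonneg measurableSet_Ioi fun r _ =>
      mul_nonneg (sq_nonneg r) (mul_self_nonneg _)
  have hN2 : 0 ≤ dirichletForm a a + dirichletForm b b := add_nonneg hDa hDa
  set N := √(dirichletForm a a + dirichletForm b b)
  set m := ∫ r in Set.Ioi (0 : ℝ), r ^ 2 * ‖F r‖ ^ 4
  have hm0 : 0 ≤ m := setIntegral_nonneg measurableSet_Ioi fun r _ => by positivity
  have hm3 : ∫ x, ‖f x‖ ^ 4 = A * m :=
    integral_eq_of_radial (φ := fun r => ‖F r‖ ^ 4) fun x _ => by rw [hfF]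
  have hDF : ∫ r in Set.Ioi (0 : ℝ), r ^ 2 * ‖deriv F r‖ ^ 2
      = ∫ r in Set.Ioi (0 : ℝ),
        r ^ 2 * ((deriv radialW r + deriv a r) ^ 2 + deriv b r ^ 2) := by
    rw [← integral_Ioi_scale _ hμi]
    simp only [← scale2, normdv]
  have hSF : ∫ r in Set.Ioi (0 : ℝ), r ^ 2 * ‖F r‖ ^ 6
      = ∫ r in Set.Ioi (0 : ℝ), r ^ 2 * ((radialW r + a r) ^ 2 + b r ^ 2) ^ 3 := by
    rw [← integral_Ioi_scale _ hμi]
    simp only [← scale6, normv]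
  set D := ∫ r in Set.Ioi (0 : ℝ),
    r ^ 2 * ((deriv radialW r + deriv a r) ^ 2 + deriv b r ^ 2)
  set S := ∫ r in Set.Ioi (0 : ℝ), r ^ 2 * ((radialW r + a r) ^ 2 + b r ^ 2) ^ 3
  have hD3 : ∫ x, gradSqC f x = A * D := by
    rw [← hDF]
    exact integral_eq_of_radial (φ := fun r => ‖deriv F r‖ ^ 2) gradf
  have hS3 : ∫ x, ‖f x‖ ^ 6 = A * S := by
    rw [← hSF]
    exact integral_eq_of_radial (φ := fun r => ‖F r‖ ^ 6) fun x _ => by rw [hfF]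
  have hEf : Ecq f = A * (1 / 2 * D - 1 / 6 * S + 1 / 4 * m) := by
    have i1 : Integrable fun x => (1 : ℝ) / 2 * gradSqC f x := hgrad.const_mul _
    have i2 : Integrable fun x => (1 : ℝ) / 6 * ‖f x‖ ^ 6 := h6.const_mul _
    have i3 : Integrable fun x => (1 : ℝ) / 4 * ‖f x‖ ^ 4 := h4.const_mul _
    have i12 : Integrable fun x => (1 : ℝ) / 2 * gradSqC f x - 1 / 6 * ‖f x‖ ^ 6 := i1.sub i2
    rw [Ecq, integral_add i12 i3, integral_sub i1 i2, integral_const_mul, integral_const_mul,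
      integral_const_mul, hD3, hS3, hm3]
    ring
  have hE1 : 1 / 2 * D - 1 / 6 * S + 1 / 4 * m
      = 1 / 2 * dirichletForm radialW radialW - 1 / 6 * weightedForm radialW radialW := by
    rw [hEf, Ecrit_Wc] at hE
    exact mul_left_cancel₀ hA.ne' hE
  have hN3 : √(∫ x, gradSqC (modG f θ μ) x) = √A * N := by
    rw [hG, Real.sqrt_mul hA.le]
  have hδ3 : deltaF f = A * |dirichletForm radialW radialW - D| := by
    rw [deltaF, integral_gradSqR_W, hD3, ← mul_sub, abs_mul, abs_of_pos hA]
  rw [hN3] at hsmall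
  obtain ⟨k1, k2, k3⟩ := key a b m _ N Ha Him hm0 (Real.sqrt_nonneg _) (Real.sq_sqrt hN2) ob oa
    (le_of_mul_le_mul_left hsmall hsA) rfl hE1
  rw [hN3, hm3, hδ3]
  set δ := |dirichletForm radialW radialW - D|
  have hδ0 : 0 ≤ δ := abs_nonneg _
  have hN0 : 0 ≤ N := Real.sqrt_nonneg _
  have e1 : C * (1 / A + √A + 1 / √A) * (A * δ) ^ 2
      = A * (C * δ ^ 2) + C * (√A + 1 / √A) * (A * δ) ^ 2 := by
    have : 1 / A * A = 1 := one_div_mul_cancel hA.ne'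
    linear_combination (C * A * δ ^ 2) * this
  have e2 : C * (1 / A + √A + 1 / √A) * (√A * N)
      = A * (C * N) + C * (1 / A + 1 / √A) * (√A * N) := by
    linear_combination (C * N) * hsA2
  have e3 : C * (1 / A + √A + 1 / √A) * (A * δ)
      = √A * (C * δ) + C * (1 / A + √A) * (A * δ) := by
    have : 1 / √A * A = √A := by rw [one_div_mul_eq_div, Real.div_sqrt]
    linear_combination (C * δ) * this
  refine ⟨?_, ?_, ?_⟩
  · rw [e1]
    exact (mul_le_mul_of_nonneg_left k1 hA.le).trans (le_add_of_nonneg_right (by positivity))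
  · rw [inv_mul_le_iff₀ (by positivity), e2]
    exact (mul_le_mul_of_nonneg_left k2 hA.le).trans (le_add_of_nonneg_right (by positivity))
  · rw [e3]
    exact (mul_le_mul_of_nonneg_left k3 hsA.le).trans (le_add_of_nonneg_right (by positivity))
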